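/- arXiv:1304.7344 — 6 statements merged into one kernel-verified Lean document; each statement's English description precedes it below -/
import Mathlib

section
/- The Gaussian cut function is submodular on subsets of the node set: for every pair of subsets S1, S2 ⊆ V, f_H(S1) + f_H(S2) ≥ f_H(S1 ∪ S2) + f_H(S1 ∩ S2). -/
open Matrix Complex

open scoped Classical

/-- The submatrix of the channel matrix `H` corresponding to a cut `S`:
rows are the receive antennas owned by nodes outside `S`, columns are the
transmit antennas owned by nodes inside `S`. -/
noncomputable def cutMatrix {V T Rx : Type*} (τ : T → V) (ρ : Rx → V)
    (H : Matrix Rx T ℂ) (S : Set V) :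
    Matrix {r : Rx // ρ r ∉ S} {t : T // τ t ∈ S} ℂ :=
  fun r t => H r.1 t.1

/-- The Gaussian cut value `f_H(S) = log re (det (1 + H_S * diagonal p * H_Sᴴ))`. -/
noncomputable def cutValue {V T Rx : Type*} [Fintype T] [Fintype Rx]
    (τ : T → V) (ρ : Rx → V) (H : Matrix Rx T ℂ) (p : T → ℝ) (S : Set V) : ℝ :=
  Real.log ((1 + cutMatrix τ ρ H S *
      Matrix.diagonal (fun t : {t : T // τ t ∈ S} => (p t.1 : ℂ)) *
      (cutMatrix τ ρ H S)ᴴ).det.re)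

namespace Matrix

section LogDet

open scoped ComplexOrder

variable {𝕜 m n : Type*} [RCLike 𝕜]

theorem IsHermitian.conjTranspose_toBlocks₁₂ {M : Matrix (m ⊕ n) (m ⊕ n) 𝕜} (hM : M.IsHermitian) :
    M.toBlocks₁₂ᴴ = M.toBlocks₂₁ := by
  ext i j
  exact hM.apply _ _

theorem PosDef.toBlocks₁₁ {M : Matrix (m ⊕ n) (m ⊕ n) 𝕜} (hM : M.PosDef) : M.toBlocks₁₁.PosDef :=
  hM.submatrix Sum.inl_injective

variable [Fintype m]

/-- The Schur complement of the upper left block. -/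
noncomputable def schurComplement [DecidableEq m] (M : Matrix (m ⊕ n) (m ⊕ n) 𝕜) : Matrix n n 𝕜 :=
  M.toBlocks₂₂ - M.toBlocks₂₁ * M.toBlocks₁₁⁻¹ * M.toBlocks₁₂

/-- Principal minors containing the upper left block, in terms of the Schur complement. -/
theorem PosDef.det_submatrix_sumMap [DecidableEq m] {l : Type*} [Fintype l] [DecidableEq l]
    {M : Matrix (m ⊕ n) (m ⊕ n) 𝕜} (hM : M.PosDef) (f : l → n) :
    (M.submatrix (Sum.map id f) (Sum.map id f)).det =
      M.toBlocks₁₁.det * (M.schurComplement.submatrix f f).det := by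
  let := hM.toBlocks₁₁.isUnit.invertible
  have h : M.submatrix (Sum.map id f) (Sum.map id f) =
      fromBlocks M.toBlocks₁₁ (M.toBlocks₁₂.submatrix id f) (M.toBlocks₂₁.submatrix f id)
        (M.toBlocks₂₂.submatrix f f) := by
    ext (i | i) (j | j) <;> rfl
  rw [h, det_fromBlocks₁₁, invOf_eq_nonsing_inv]
  rfl

variable [Fintype n]

theorem PosSemidef.one_le_det_one_add [DecidableEq n] {A : Matrix n n 𝕜} (hA : A.PosSemidef) :
    1 ≤ (1 + A).det := by
  have h : (1 + A).det = ∏ i, (1 + (hA.1.eigenvalues i : 𝕜)) := by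
    conv_lhs => rw [hA.1.spectral_theorem,
      ← map_one (Unitary.conjStarAlgAut 𝕜 _ hA.1.eigenvectorUnitary), ← map_add,
      Unitary.conjStarAlgAut_apply, ← diagonal_one, diagonal_add, det_mul_comm, ← mul_assoc,
      Unitary.coe_star_mul_self, one_mul, det_diagonal]
    rfl
  rw [h]
  have h' : (1 : ℝ) ≤ ∏ i, (1 + hA.1.eigenvalues i) := by
    refine Finset.prod_const_one.symm.trans_le (Finset.prod_le_prod (fun _ _ => zero_le_one) ?_)
    exact fun i _ => le_add_of_nonneg_right (hA.eigenvalues_nonneg i)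
  exact_mod_cast (RCLike.ofReal_le_ofReal (K := 𝕜)).2 h'

/-- The determinant is monotone for the Loewner order. -/
theorem PosDef.det_le_det_add [DecidableEq n] {A E : Matrix n n 𝕜} (hA : A.PosDef)
    (hE : E.PosSemidef) : A.det ≤ (A + E).det := by
  open scoped MatrixOrder in
  obtain ⟨F, rfl⟩ := CStarAlgebra.nonneg_iff_eq_star_mul_self.mp hE.nonneg
  rw [star_eq_conjTranspose, det_add_mul _ _ ((isUnit_iff_isUnit_det A).1 hA.isUnit)]
  exact le_mul_of_one_le_right hA.det_pos.le
    (hA.inv.posSemidef.mul_mul_conjTranspose_same F).one_le_det_one_add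

theorem PosDef.det_eq_mul_det_schurComplement [DecidableEq m] [DecidableEq n]
    {M : Matrix (m ⊕ n) (m ⊕ n) 𝕜} (hM : M.PosDef) :
    M.det = M.toBlocks₁₁.det * M.schurComplement.det := by
  simpa using hM.det_submatrix_sumMap id

theorem PosDef.schurComplement [DecidableEq m] {M : Matrix (m ⊕ n) (m ⊕ n) 𝕜} (hM : M.PosDef) :
    M.schurComplement.PosDef := by
  let := hM.toBlocks₁₁.isUnit.invertible
  have h : M.schurComplement.PosSemidef := by
    rw [Matrix.schurComplement, ← hM.1.conjTranspose_toBlocks₁₂,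
      ← hM.toBlocks₁₁.fromBlocks₁₁, hM.1.conjTranspose_toBlocks₁₂, fromBlocks_toBlocks]
    exact hM.posSemidef
  refine h.posDef_iff_det_ne_zero.2 fun h0 => hM.det_pos.ne' ?_
  rw [hM.det_eq_mul_det_schurComplement, h0, mul_zero]

/-- **Fischer's inequality**. -/
theorem PosDef.det_le_det_toBlocks_mul [DecidableEq m] [DecidableEq n]
    {M : Matrix (m ⊕ n) (m ⊕ n) 𝕜} (hM : M.PosDef) :
    M.det ≤ M.toBlocks₁₁.det * M.toBlocks₂₂.det := by
  rw [hM.det_eq_mul_det_schurComplement]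
  refine mul_le_mul_of_nonneg_left ?_ hM.toBlocks₁₁.det_pos.le
  have h := hM.schurComplement.det_le_det_add
    (hM.toBlocks₁₁.inv.posSemidef.conjTranspose_mul_mul_same M.toBlocks₁₂)
  rwa [hM.1.conjTranspose_toBlocks₁₂, Matrix.schurComplement, sub_add_cancel] at h

theorem PosDef.det_mul_det_le_of_sum [DecidableEq m] [DecidableEq n] {l : Type*} [Fintype l]
    [DecidableEq l] {M : Matrix (l ⊕ (m ⊕ n)) (l ⊕ (m ⊕ n)) 𝕜} (hM : M.PosDef) :
    M.det * (M.submatrix Sum.inl Sum.inl).det ≤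
      (M.submatrix (Sum.map id Sum.inl) (Sum.map id Sum.inl)).det *
        (M.submatrix (Sum.map id Sum.inr) (Sum.map id Sum.inr)).det := by
  rw [hM.det_submatrix_sumMap, hM.det_submatrix_sumMap, hM.det_eq_mul_det_schurComplement]
  have h := mul_le_mul_of_nonneg_left hM.schurComplement.det_le_det_toBlocks_mul
    (mul_nonneg hM.toBlocks₁₁.det_pos.le hM.toBlocks₁₁.det_pos.le)
  calc _ = M.toBlocks₁₁.det * M.toBlocks₁₁.det * M.schurComplement.det :=
        mul_right_comm _ _ _
    _ ≤ _ := h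
    _ = _ := mul_mul_mul_comm _ _ _ _

/-- The minor of `M` with rows and columns in `s`. -/
noncomputable def principalMinor {R : Type*} [CommRing R] (M : Matrix n n R) (s : Set n) : R :=
  (M.submatrix ((↑) : s → n) (↑)).det

theorem det_submatrix_eq_principalMinor [DecidableEq m] {R : Type*} [CommRing R]
    (M : Matrix n n R) {f : m → n} (hf : f.Injective) {s : Set n} (h : Set.range f = s) :
    (M.submatrix f f).det = M.principalMinor s := by
  let e : m ≃ s := (Equiv.ofInjective f hf).trans (Equiv.setCongr h)
  exact (det_submatrix_equiv_self e (M.submatrix ((↑) : s → n) (↑))).symm ▸ rfl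

theorem PosDef.principalMinor_pos {M : Matrix n n 𝕜} (hM : M.PosDef) (s : Set n) :
    0 < M.principalMinor s :=
  (hM.submatrix Subtype.val_injective).det_pos

/-- **Koteljanskii's inequality**: principal minors of a positive definite matrix are
log-submodular. -/
theorem PosDef.principalMinor_union_mul_inter_le {M : Matrix n n 𝕜} (hM : M.PosDef) (s t : Set n) :
    M.principalMinor (s ∪ t) * M.principalMinor (s ∩ t) ≤
      M.principalMinor s * M.principalMinor t := by
  let g : ↥(s ∩ t) ⊕ (↥(s \ t) ⊕ ↥(t \ s)) → n := Sum.elim (↑) (Sum.elim (↑) (↑))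
  have hg : g.Injective := by
    rintro (⟨i, hi⟩ | ⟨i, hi⟩ | ⟨i, hi⟩) (⟨j, hj⟩ | ⟨j, hj⟩ | ⟨j, hj⟩) h <;>
      simp only [g, Sum.elim_inl, Sum.elim_inr] at h <;> subst h <;>
      simp only [Set.mem_inter_iff, Set.mem_sdiff] at hi hj <;> first | rfl | tauto
  have key := (hM.submatrix hg).det_mul_det_le_of_sum
  simp only [submatrix_submatrix] at key
  rw [det_submatrix_eq_principalMinor M hg (s := s ∪ t),
    det_submatrix_eq_principalMinor M (hg.comp Sum.inl_injective) (s := s ∩ t),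
    det_submatrix_eq_principalMinor M
      (hg.comp (Function.injective_id.sumMap Sum.inl_injective)) (s := s),
    det_submatrix_eq_principalMinor M
      (hg.comp (Function.injective_id.sumMap Sum.inr_injective)) (s := t)] at key
  · exact key
  all_goals
    ext i
    simp [g]
    try tauto

/-- The logarithm of the principal minors of a positive definite matrix is submodular. -/
theorem PosDef.log_re_principalMinor_union_add_inter_le {M : Matrix n n 𝕜} (hM : M.PosDef)
    (s t : Set n) :
    Real.log (RCLike.re (M.principalMinor (s ∪ t))) +
        Real.log (RCLike.re (M.principalMinor (s ∩ t))) ≤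
      Real.log (RCLike.re (M.principalMinor s)) + Real.log (RCLike.re (M.principalMinor t)) := by
  have hpos (u : Set n) := RCLike.pos_iff.1 (hM.principalMinor_pos u)
  rw [← Real.log_mul (hpos _).1.ne' (hpos _).1.ne', ← Real.log_mul (hpos _).1.ne' (hpos _).1.ne']
  refine Real.log_le_log (mul_pos (hpos _).1 (hpos _).1) ?_
  have h := (RCLike.le_iff_re_im.1 (hM.principalMinor_union_mul_inter_le s t)).1
  rw [RCLike.mul_re, RCLike.mul_re] at h
  simpa only [(hpos _).2, mul_zero, sub_zero] using h

/-- The covariance matrix of `(x, G x + z)`, for independent `x` and `z` with identity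
covariance. -/
noncomputable def jointCovariance (G : Matrix m n 𝕜) : Matrix (n ⊕ m) (n ⊕ m) 𝕜 :=
  fromBlocks 1 Gᴴ G (G * Gᴴ + 1)

theorem posDef_jointCovariance (G : Matrix m n 𝕜) : (jointCovariance G).PosDef := by
  have h : jointCovariance G = fromBlocks 1 0 G 1 * (fromBlocks 1 0 G 1)ᴴ := by
    simp [jointCovariance, fromBlocks_conjTranspose, fromBlocks_multiply]
  have hdet : (jointCovariance G).det ≠ 0 := by
    rw [h, det_mul, det_conjTranspose, det_fromBlocks_zero₁₂]
    simp
  refine PosSemidef.posDef_iff_det_ne_zero ?_ |>.2 hdet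
  rw [h]
  exact posSemidef_self_mul_conjTranspose _

end LogDet

end Matrix

theorem cutValue_eq_log_re_principalMinor {V T Rx : Type*} [Fintype T] [Fintype Rx]
    (τ : T → V) (ρ : Rx → V) (H : Matrix Rx T ℂ) (p : T → ℝ) (hp : ∀ t, 0 ≤ p t) (S : Set V) :
    cutValue τ ρ H p S = Real.log (RCLike.re
      ((jointCovariance (H * diagonal fun t => ((√(p t) : ℝ) : ℂ))).principalMinor
        {x | Sum.elim τ ρ x ∉ S})) := by
  set G := H * diagonal fun t => ((√(p t) : ℝ) : ℂ) with hG
  let f : {t // τ t ∉ S} ⊕ {r // ρ r ∉ S} → T ⊕ Rx := Sum.map (↑) (↑)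
  have hf : f.Injective := Subtype.val_injective.sumMap Subtype.val_injective
  rw [← det_submatrix_eq_principalMinor _ hf (by ext (t | r) <;> simp [f])]
  have hblocks : (jointCovariance G).submatrix f f =
      fromBlocks 1 (Gᴴ.submatrix (↑) (↑)) (G.submatrix (↑) (↑))
        ((G * Gᴴ + 1).submatrix (↑) (↑)) := by
    ext (i | i) (j | j) <;> simp [f, jointCovariance, one_apply, Subtype.ext_iff]
  rw [hblocks, det_fromBlocks_one₁₁, cutValue, RCLike.re_eq_complex_re]
  congr 3
  refine Matrix.ext fun r r' => ?_
  have hGG (t : T) : G r t * star (G r' t) = H r t * p t * star (H r' t) := by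
    have h : ((√(p t) : ℝ) : ℂ) * ((√(p t) : ℝ) : ℂ) = p t := by
      exact_mod_cast Real.mul_self_sqrt (hp t)
    simp only [hG, mul_diagonal, star_mul', RCLike.star_def, conj_ofReal]
    rw [← h]
    ring
  have hsum := Fintype.sum_subtype_add_sum_subtype (fun t => τ t ∈ S)
    fun t => G r t * star (G r' t)
  simp only [Matrix.add_apply, Matrix.sub_apply, submatrix_apply, mul_apply (M := G), conjTranspose_apply,
    mul_apply (M := G.submatrix _ _), mul_apply (N := (cutMatrix τ ρ H S)ᴴ), mul_diagonal,
    cutMatrix, ← hGG, one_apply, Subtype.ext_iff]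
  rw [← hsum]
  ring

/-- The Gaussian cut function is submodular on subsets of the node
set: for every pair of subsets `S1, S2 ⊆ V`,
`f_H(S1) + f_H(S2) ≥ f_H(S1 ∪ S2) + f_H(S1 ∩ S2)`. -/
theorem cutValue_submodular {V T Rx : Type*} [Fintype V] [Fintype T] [Fintype Rx]
    (τ : T → V) (ρ : Rx → V) (H : Matrix Rx T ℂ) (p : T → ℝ) (hp : ∀ t, 0 ≤ p t) :
    ∀ S1 S2 : Set V,
      cutValue τ ρ H p (S1 ∪ S2) + cutValue τ ρ H p (S1 ∩ S2) ≤
        cutValue τ ρ H p S1 + cutValue τ ρ H p S2 := by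
  intro S1 S2
  simp only [cutValue_eq_log_re_principalMinor τ ρ H p hp]
  have h := (posDef_jointCovariance
    (H * diagonal fun t => ((√(p t) : ℝ) : ℂ))).log_re_principalMinor_union_add_inter_le
      {x | Sum.elim τ ρ x ∉ S1} {x | Sum.elim τ ρ x ∉ S2}
  have hunion : {x | Sum.elim τ ρ x ∉ S1 ∩ S2} =
      {x | Sum.elim τ ρ x ∉ S1} ∪ {x | Sum.elim τ ρ x ∉ S2} := by
    ext x
    simp only [Set.mem_ofPred_eq, Set.mem_inter_iff, Set.mem_union, not_and_or]
  have hinter : {x | Sum.elim τ ρ x ∉ S1 ∪ S2} =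
      {x | Sum.elim τ ρ x ∉ S1} ∩ {x | Sum.elim τ ρ x ∉ S2} := by
    ext x
    simp only [Set.mem_ofPred_eq, Set.mem_inter_iff, Set.mem_union, not_or]
  rw [← hunion, ← hinter, add_comm] at h
  exact h
end

section
/- For every m × n complex matrix A and every function d : n → ℝ with d j ≥ 0 for all j, the determinant det(1 + A * diagonal d * Aᴴ) is a real number at least 1: its imaginary part is 0 and its real part is ≥ 1. -/
open Matrix Complex

theorem Matrix.IsHermitian.det_one_add_eq_prod_eigenvalues {𝕜 m : Type*} [RCLike 𝕜] [Fintype m]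
    [DecidableEq m] {M : Matrix m m 𝕜} (hM : M.IsHermitian) :
    (1 + M).det = ((∏ i, (1 + hM.eigenvalues i) : ℝ) : 𝕜) := by
  conv_lhs => rw [hM.spectral_theorem, Unitary.conjStarAlgAut_apply, mul_assoc,
    det_one_add_mul_comm, mul_assoc, Unitary.coe_star_mul_self, mul_one, ← diagonal_one,
    diagonal_add, det_diagonal]
  simp

open scoped ComplexOrder in
/-- For every `m × n` complex matrix `A` and every function `d : n → ℝ`
with `d j ≥ 0` for all `j`, the determinant `det (1 + A * diagonal d * Aᴴ)` is a real
number at least `1`: its imaginary part is `0` and its real part is `≥ 1`. -/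
theorem det_one_add_mul_diagonal_mul_conjTranspose_real_and_ge_one
    {m n : Type*} [Fintype m] [Fintype n] [DecidableEq m] [DecidableEq n]
    (A : Matrix m n ℂ) (d : n → ℝ) (hd : ∀ j, 0 ≤ d j) :
    ((1 + A * Matrix.diagonal (fun j => (d j : ℂ)) * Aᴴ).det).im = 0 ∧
      1 ≤ ((1 + A * Matrix.diagonal (fun j => (d j : ℂ)) * Aᴴ).det).re := by
  have hdiag : (diagonal fun j => (d j : ℂ)).PosSemidef :=
    posSemidef_diagonal_iff.mpr fun j => Complex.zero_le_real.mpr (hd j)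
  have hM := hdiag.mul_mul_conjTranspose_same A
  rw [hM.isHermitian.det_one_add_eq_prod_eigenvalues]
  refine ⟨Complex.ofReal_im _, ?_⟩
  refine le_of_le_of_eq ?_ (Complex.ofReal_re _).symm
  exact Finset.one_le_prod fun i _ => le_add_of_nonneg_right (hM.eigenvalues_nonneg i)
end

section
/- Let V be a finite type, let s, d ∈ V with s ≠ d, let u, v ∈ V with u ≠ v, and let f, f', f'', f''' : Set V → ℝ all be submodular. Assume: (1) f S = f' S for every S ⊆ V with ¬(v ∈ S ∧ u ∉ S); (2) f S = f'' S for every S with ¬(u ∈ S ∧ v ∉ S); (3) f' S = f''' S for every S with ¬(u ∈ S ∧ v ∉ S); (4) f'' S = f''' S for every S with ¬(v ∈ S ∧ u ∉ S). Then the minimum of f' over all s–d cuts equals the minimum of f over all s–d cuts, or the minimum of f'' over all s–d cuts equals the minimum of f over all s–d cuts. -/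
/-- A function `g : Set V → ℝ` is submodular if
`g S1 + g S2 ≥ g (S1 ∪ S2) + g (S1 ∩ S2)` for all `S1, S2 ⊆ V`. -/
def Submodular {V : Type*} (g : Set V → ℝ) : Prop :=
  ∀ S1 S2 : Set V, g (S1 ∪ S2) + g (S1 ∩ S2) ≤ g S1 + g S2

/-- The minimum of `f` over all `s`–`d` cuts, i.e. over all `S ⊆ V` with `s ∈ S` and
`d ∉ S`.  For `V` finite and `s ≠ d` this collection is finite and nonempty, so the
infimum below is attained and is the minimum. -/
noncomputable def cutMin {V : Type*} (s d : V) (f : Set V → ℝ) : ℝ :=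
  sInf (f '' {S : Set V | s ∈ S ∧ d ∉ S})

/-- The minimum over all `s`–`d` cuts is attained. -/
theorem exists_cut_eq_cutMin {V : Type*} [Finite V] {s d : V} (hsd : s ≠ d) (g : Set V → ℝ) :
    ∃ S : Set V, (s ∈ S ∧ d ∉ S) ∧ g S = cutMin s d g := by
  have hne : (g '' {S : Set V | s ∈ S ∧ d ∉ S}).Nonempty :=
    ⟨g {s}, {s}, ⟨rfl, fun h => hsd h.symm⟩, rfl⟩
  exact hne.csInf_mem (Set.toFinite _)

/-- The minimum over all `s`–`d` cuts is a lower bound for the value of each cut. -/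
theorem cutMin_le {V : Type*} [Finite V] {s d : V} (g : Set V → ℝ) {S : Set V}
    (hs : s ∈ S) (hd : d ∉ S) : cutMin s d g ≤ g S :=
  csInf_le (Set.toFinite _).bddBelow ⟨S, ⟨hs, hd⟩, rfl⟩

/-- If `g` is submodular and agrees with `f` on sets that do not separate `u` and `v`, then
cuts separating `u` and `v` in opposite directions have total `g`-value at least twice the
minimum of `f`. -/
theorem two_mul_cutMin_le_of_crossing {V : Type*} [Finite V] {s d u v : V} {f g : Set V → ℝ}
    (hg : Submodular g) (hfg : ∀ S : Set V, (u ∈ S ↔ v ∈ S) → f S = g S) {A B : Set V}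
    (hA : s ∈ A ∧ d ∉ A) (hB : s ∈ B ∧ d ∉ B) (hvA : v ∈ A ∧ u ∉ A) (huB : u ∈ B ∧ v ∉ B) :
    2 * cutMin s d f ≤ g A + g B := by
  have hsub := hg A B
  rw [← hfg (A ∪ B) (by simp [hvA, huB]), ← hfg (A ∩ B) (by simp [hvA, huB])] at hsub
  have hunion : cutMin s d f ≤ f (A ∪ B) := cutMin_le f (by simp [hA]) (by simp [hA, hB])
  have hinter : cutMin s d f ≤ f (A ∩ B) := cutMin_le f (by simp [hA, hB]) (by simp [hA])
  linarith

/-- Removing one direction of the bidirected link `(u,v)`/`(v,u)`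
preserves the min-cut: either the min-cut of `G'` (link `(v,u)` removed, cut function
`f'`) or that of `G''` (link `(u,v)` removed, cut function `f''`) equals the min-cut of
`G` (cut function `f`).  Here `f'''` is the cut function with both links removed. -/
theorem mincut_remove_one_direction {V : Type*} [Fintype V]
    (s d : V) (hsd : s ≠ d) (u v : V) (huv : u ≠ v)
    (f f' f'' f''' : Set V → ℝ)
    (hf : Submodular f) (hf' : Submodular f')
    (hf'' : Submodular f'') (hf''' : Submodular f''')
    (h1 : ∀ S : Set V, ¬(v ∈ S ∧ u ∉ S) → f S = f' S)
    (h2 : ∀ S : Set V, ¬(u ∈ S ∧ v ∉ S) → f S = f'' S)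
    (h3 : ∀ S : Set V, ¬(u ∈ S ∧ v ∉ S) → f' S = f''' S)
    (h4 : ∀ S : Set V, ¬(v ∈ S ∧ u ∉ S) → f'' S = f''' S) :
    cutMin s d f' = cutMin s d f ∨ cutMin s d f'' = cutMin s d f := by
  by_contra! hne
  obtain ⟨hne', hne''⟩ := hne
  obtain ⟨S, hS, hSf⟩ := exists_cut_eq_cutMin hsd f
  obtain ⟨A, hA, hAf⟩ := exists_cut_eq_cutMin hsd f'
  obtain ⟨B, hB, hBf⟩ := exists_cut_eq_cutMin hsd f''
  have hfg' : ∀ T : Set V, (u ∈ T ↔ v ∈ T) → f T = f' T := fun T hT => h1 T (by tauto)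
  have hfg'' : ∀ T : Set V, (u ∈ T ↔ v ∈ T) → f T = f'' T := fun T hT => h2 T (by tauto)
  have hfg''' : ∀ T : Set V, (u ∈ T ↔ v ∈ T) → f T = f''' T := fun T hT =>
    (hfg' T hT).trans (h3 T (by tauto))
  have hA_lt : ¬(v ∈ S ∧ u ∉ S) → cutMin s d f' < cutMin s d f ∧ v ∈ A ∧ u ∉ A := by
    intro h
    have hlt : cutMin s d f' < cutMin s d f :=
      lt_of_le_of_ne (by rw [← hSf, h1 S h]; exact cutMin_le f' hS.1 hS.2) hne'
    refine ⟨hlt, by_contra fun hn => ?_⟩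
    have := cutMin_le f hA.1 hA.2
    linarith [h1 A hn]
  have hB_lt : ¬(u ∈ S ∧ v ∉ S) → cutMin s d f'' < cutMin s d f ∧ u ∈ B ∧ v ∉ B := by
    intro h
    have hlt : cutMin s d f'' < cutMin s d f :=
      lt_of_le_of_ne (by rw [← hSf, h2 S h]; exact cutMin_le f'' hS.1 hS.2) hne''
    refine ⟨hlt, by_contra fun hn => ?_⟩
    have := cutMin_le f hB.1 hB.2
    linarith [h2 B hn]
  by_cases hSv : v ∈ S ∧ u ∉ S
  · have hSu : ¬(u ∈ S ∧ v ∉ S) := by tauto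
    obtain ⟨hlt, huB⟩ := hB_lt hSu
    linarith [two_mul_cutMin_le_of_crossing hf'' hfg'' hS hB hSv huB, h2 S hSu]
  · obtain ⟨hlt', hvA⟩ := hA_lt hSv
    by_cases hSu : u ∈ S ∧ v ∉ S
    · linarith [two_mul_cutMin_le_of_crossing hf' hfg' hA hS hvA hSu, h1 S hSv]
    · obtain ⟨hlt'', huB⟩ := hB_lt hSu
      linarith [two_mul_cutMin_le_of_crossing hf''' hfg''' hA hB hvA huB,
        h3 A (by tauto), h4 B (by tauto)]
end

section
/- Let V be a finite type, let s, d ∈ V with s ≠ d, and let F : Set (V × V) → Set V → ℝ be a family of cut functions satisfying: (i) for every E ⊆ V × V, the function F E is submodular; (ii) for all E, E' ⊆ V × V and every S ⊆ V, if {e ∈ E | e.1 ∈ S ∧ e.2 ∉ S} = {e ∈ E' | e.1 ∈ S ∧ e.2 ∉ S} then F E S = F E' S. Then for every edge set E₀ ⊆ V × V there exists an acyclic edge set E' ⊆ E₀ such that the minimum of F E' over all s–d cuts equals the minimum of F E₀ over all s–d cuts. -/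
/-- An edge set `E ⊆ V × V` is acyclic if the transitive closure of the corresponding
relation is irreflexive (no directed cycles; in particular no self-loops and no pair of
oppositely directed edges). -/
def AcyclicEdgeSet {V : Type*} (E : Set (V × V)) : Prop :=
  Irreflexive (Relation.TransGen fun u w => (u, w) ∈ E)

section

variable {V : Type*}

/-- A pair connected by the transitive closure of the edge relation is joined by a walk, recorded
through its multiset of edges, along which every potential telescopes. -/
theorem exists_edges_of_transGen {E : Set (V × V)} {x y : V}
    (h : Relation.TransGen (fun u w => (u, w) ∈ E) x y) :
    ∃ l : Multiset (V × V), l ≠ 0 ∧ (∀ e ∈ l, e ∈ E) ∧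
      ∀ φ : V → ℤ, (l.map fun e => φ e.1 - φ e.2).sum = φ x - φ y := by
  induction h with
  | @single y hxy =>
    exact ⟨{(x, y)}, Multiset.singleton_ne_zero _, by simpa using hxy, by simp⟩
  | @tail y z _ hyz ih =>
    obtain ⟨l, -, hl, hsum⟩ := ih
    refine ⟨(y, z) ::ₘ l, Multiset.cons_ne_zero, ?_, fun φ => ?_⟩
    · simpa using ⟨hyz, fun a b => hl (a, b)⟩
    · rw [Multiset.map_cons, Multiset.sum_cons, hsum]
      ring

/-- If the symmetrization of `a` is nonnegative and positive on the diagonal over a nonempty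
multiset, then the rows of `a` cannot all sum to zero. -/
theorem not_forall_sum_eq_zero_of_add_swap_nonneg {α : Type*} {l : Multiset α} (hl : l ≠ 0)
    {a : α → α → ℤ} (ha : ∀ i ∈ l, ∀ j ∈ l, 0 ≤ a i j + a j i) (hdiag : ∀ i ∈ l, 0 < a i i) :
    ¬ ∀ i ∈ l, (l.map (a i)).sum = 0 := by
  intro hzero
  obtain ⟨i, hi⟩ := Multiset.exists_mem_of_ne_zero hl
  have hrow : ∀ i ∈ l, (l.map fun j => a j i).sum = (l.map fun j => a i j + a j i).sum := by
    intro i hi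
    rw [Multiset.sum_map_add, hzero i hi, zero_add]
  have hnonneg : ∀ i ∈ l, 0 ≤ (l.map fun j => a j i).sum := by
    intro i hi
    rw [hrow i hi]
    refine Multiset.sum_nonneg fun x hx => ?_
    obtain ⟨j, hj, rfl⟩ := Multiset.mem_map.1 hx
    exact ha i hi j hj
  have htotal : (l.map fun i => (l.map fun j => a j i).sum).sum = 0 := by
    rw [Multiset.sum_map_sum_map, Multiset.map_congr rfl hzero]
    simp
  have hle : (l.map fun j => a j i).sum ≤ 0 := by
    rw [← htotal]
    refine Multiset.single_le_sum (fun x hx => ?_) _ (Multiset.mem_map_of_mem _ hi)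
    obtain ⟨j, hj, rfl⟩ := Multiset.mem_map.1 hx
    exact hnonneg j hj
  have hge : a i i + a i i ≤ (l.map fun j => a j i).sum := by
    rw [hrow i hi]
    refine Multiset.single_le_sum (fun x hx => ?_) _
      (Multiset.mem_map_of_mem (fun j => a i j + a j i) hi)
    obtain ⟨j, hj, rfl⟩ := Multiset.mem_map.1 hx
    exact ha i hi j hj
  have := hdiag i hi
  omega

/-- The values of `F` depend only on the edges going out of the cut. -/
def DependsOnOutEdges (F : Set (V × V) → Set V → ℝ) : Prop :=
  ∀ E E' : Set (V × V), ∀ S : Set V,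
    {e ∈ E | e.1 ∈ S ∧ e.2 ∉ S} = {e ∈ E' | e.1 ∈ S ∧ e.2 ∉ S} → F E S = F E' S

theorem DependsOnOutEdges.diff_singleton {F : Set (V × V) → Set V → ℝ}
    (hF : DependsOnOutEdges F) (E : Set (V × V)) {e : V × V} {S : Set V}
    (he : e.1 ∈ S → e.2 ∈ S) : F (E \ {e}) S = F E S := by
  apply hF
  ext f
  simp only [Set.mem_ofPred_eq, Set.mem_sdiff, Set.mem_singleton_iff]
  constructor
  · tauto
  · rintro ⟨hf, h1, h2⟩
    exact ⟨⟨hf, by rintro rfl; exact h2 (he h1)⟩, h1, h2⟩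

/-- Uncrossing: let every cut of the lattice `L` have value at least `m` in `E`, let `A` be a
minimum cut after deleting `e`, and let `B` have value below `m` after deleting `f`.
If `f` enters `A`, then `e` leaves `B`. -/
theorem mem_and_notMem_of_enters {F : Set (V × V) → Set V → ℝ}
    (hsub : ∀ E, Submodular (F E)) (hF : DependsOnOutEdges F) {L : Set (Set V)}
    (hsup : ∀ S ∈ L, ∀ T ∈ L, S ∪ T ∈ L) (hinf : ∀ S ∈ L, ∀ T ∈ L, S ∩ T ∈ L)
    {E : Set (V × V)} {m : ℝ} (hm : ∀ S ∈ L, m ≤ F E S) {e f : V × V} {A B : Set V}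
    (hA : A ∈ L) (hB : B ∈ L) (hAmin : ∀ S ∈ L, F (E \ {e}) A ≤ F (E \ {e}) S)
    (hBlt : F (E \ {f}) B < m) (he : e.1 ∈ A ∧ e.2 ∉ A) (hf : f.1 ∉ A ∧ f.2 ∈ A) :
    e.1 ∈ B ∧ e.2 ∉ B := by
  by_contra hcon
  have h := hsub ((E \ {e}) \ {f}) A B
  rw [hF.diff_singleton (e := f) (S := A ∪ B) _ fun _ => Or.inl hf.2,
    hF.diff_singleton (e := f) (S := A ∩ B) _ fun h => absurd h.1 hf.1,
    hF.diff_singleton (e := f) (S := A) _ fun h => absurd h hf.1,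
    Set.sdiff_sdiff_comm, hF.diff_singleton (e := e) (S := B) _ (by tauto)] at h
  have hU := hAmin _ (hsup A hA B hB)
  have hI := hAmin _ (hinf A hA B hB)
  by_cases h1 : e.1 ∈ B
  · rw [hF.diff_singleton (e := e) (S := A ∪ B) _ fun _ => Or.inr (by tauto)] at h
    linarith [hm _ (hsup A hA B hB)]
  · rw [hF.diff_singleton (e := e) (S := A ∩ B) _ fun h => absurd h.2 h1] at h
    linarith [hm _ (hinf A hA B hB)]

/-- Let every cut of the finite lattice `L` have value at least `m` in `E`, and let no edge of `E`
enter `T`. If deleting any edge of `E` that does not leave `T` drops some cut of `L` below `m`,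
then `E` is acyclic. -/
theorem acyclicEdgeSet_of_forall_exists_lt {F : Set (V × V) → Set V → ℝ}
    (hsub : ∀ E, Submodular (F E)) (hF : DependsOnOutEdges F) {L : Set (Set V)}
    (hL : L.Finite) (hsup : ∀ S ∈ L, ∀ T ∈ L, S ∪ T ∈ L) (hinf : ∀ S ∈ L, ∀ T ∈ L, S ∩ T ∈ L)
    {E : Set (V × V)} {m : ℝ} (hm : ∀ S ∈ L, m ≤ F E S) {T : Set V}
    (hlt : ∀ e ∈ E, (e.1 ∈ T → e.2 ∈ T) → ∃ S ∈ L, F (E \ {e}) S < m)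
    (hT : ∀ e ∈ E, e.2 ∈ T → e.1 ∈ T) : AcyclicEdgeSet E := by
  classical
  intro x hx
  obtain ⟨l, hl0, hlE, hsum⟩ := exists_edges_of_transGen hx
  let ind (S : Set V) (v : V) : ℤ := if v ∈ S then 1 else 0
  have hl : ∀ e ∈ l, e.1 ∈ T → e.2 ∈ T := by
    intro e he h1
    by_contra h2
    have hle : ind T e.1 - ind T e.2 ≤ 0 := by
      rw [← (hsum (ind T)).trans (sub_self _)]
      refine Multiset.single_le_sum (fun z hz => ?_) _
        (Multiset.mem_map_of_mem (fun e => ind T e.1 - ind T e.2) he)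
      obtain ⟨f, hf, rfl⟩ := Multiset.mem_map.1 hz
      have := hT f (hlE f hf)
      simp only [ind]
      split_ifs <;> simp_all
    simp [ind, h1, h2] at hle
  have hex : ∀ e : V × V, ∃ A : Set V, e ∈ l →
      A ∈ L ∧ (∀ S ∈ L, F (E \ {e}) A ≤ F (E \ {e}) S) ∧ F (E \ {e}) A < m := by
    intro e
    by_cases he : e ∈ l
    · obtain ⟨S, hS, hSm⟩ := hlt e (hlE e he) (hl e he)
      obtain ⟨A, hA, hAmin⟩ := Set.exists_min_image L (F (E \ {e})) hL ⟨S, hS⟩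
      exact ⟨A, fun _ => ⟨hA, hAmin, (hAmin S hS).trans_lt hSm⟩⟩
    · exact ⟨∅, fun h => absurd h he⟩
  choose A hA using hex
  have hleave : ∀ e ∈ l, e.1 ∈ A e ∧ e.2 ∉ A e := by
    intro e he
    obtain ⟨hAL, -, hAm⟩ := hA e he
    by_contra hcon
    rw [hF.diff_singleton _ (by tauto)] at hAm
    exact absurd (hm _ hAL) (not_le.2 hAm)
  refine not_forall_sum_eq_zero_of_add_swap_nonneg hl0
    (a := fun e f => ind (A e) f.1 - ind (A e) f.2) (fun e he f hf => ?_) (fun e he => ?_)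
    fun e _ => by rw [hsum, sub_self]
  · have hef := mem_and_notMem_of_enters hsub hF hsup hinf hm (hA e he).1 (hA f hf).1
      (hA e he).2.1 (hA f hf).2.2 (hleave e he)
    have hfe := mem_and_notMem_of_enters hsub hF hsup hinf hm (hA f hf).1 (hA e he).1
      (hA f hf).2.1 (hA e he).2.2 (hleave f hf)
    simp only [ind]
    split_ifs <;> simp_all
  · simp [ind, hleave e he]

end

/-- For any family of cut functions `F` that is submodular and whose
values depend only on the edges going out of the cut, every edge set `E₀` admits an
acyclic subset `E' ⊆ E₀` with the same `s`–`d` min-cut. -/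
theorem exists_acyclic_subnetwork_same_mincut {V : Type*} [Fintype V]
    (s d : V) (hsd : s ≠ d)
    (F : Set (V × V) → Set V → ℝ)
    (hsub : ∀ E : Set (V × V), Submodular (F E))
    (hout : ∀ E E' : Set (V × V), ∀ S : Set V,
      {e ∈ E | e.1 ∈ S ∧ e.2 ∉ S} = {e ∈ E' | e.1 ∈ S ∧ e.2 ∉ S} → F E S = F E' S)
    (E₀ : Set (V × V)) :
    ∃ E' ⊆ E₀, AcyclicEdgeSet E' ∧ cutMin s d (F E') = cutMin s d (F E₀) := by
  set L : Set (Set V) := {S : Set V | s ∈ S ∧ d ∉ S}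
  have hL : L.Finite := Set.toFinite L
  have hne : L.Nonempty := ⟨{s}, rfl, fun h => hsd (Set.mem_singleton_iff.1 h).symm⟩
  have hsup : ∀ S ∈ L, ∀ T ∈ L, S ∪ T ∈ L := fun S hS T hT =>
    ⟨Or.inl hS.1, fun h => h.elim hS.2 hT.2⟩
  have hinf : ∀ S ∈ L, ∀ T ∈ L, S ∩ T ∈ L := fun S hS T hT =>
    ⟨⟨hS.1, hT.1⟩, fun h => hS.2 h.1⟩
  obtain ⟨T, hT, hTm⟩ := (hne.image (F E₀)).csInf_mem (hL.image _)
  change F E₀ T = cutMin s d (F E₀) at hTm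
  have hm₀ : ∀ S ∈ L, cutMin s d (F E₀) ≤ F E₀ S := fun S hS =>
    csInf_le (hL.image _).bddBelow (Set.mem_image_of_mem _ hS)
  generalize cutMin s d (F E₀) = m at hTm hm₀ ⊢
  have hF : DependsOnOutEdges F := hout
  obtain ⟨E, hE₀, ⟨hm, hTE⟩, hmin⟩ := exists_minimal_le_of_wellFoundedLT
    (fun E => (∀ S ∈ L, m ≤ F E S) ∧ F E T = m) E₀ ⟨hm₀, hTm⟩
  have hlt : ∀ e ∈ E, (e.1 ∈ T → e.2 ∈ T) → ∃ S ∈ L, F (E \ {e}) S < m := by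
    intro e he heT
    by_contra! hcon
    exact (hmin ⟨hcon, (hF.diff_singleton E heT).trans hTE⟩ Set.sdiff_subset he).2 rfl
  refine ⟨E, hE₀, acyclicEdgeSet_of_forall_exists_lt hsub hF hL hsup hinf hm hlt ?_, ?_⟩
  · intro e he h2
    by_contra h1
    obtain ⟨S, hS, hSm⟩ := hlt e he fun _ => h2
    have h := hsub (E \ {e}) T S
    rw [hF.diff_singleton (S := T ∪ S) E fun _ => Or.inl h2,
      hF.diff_singleton (S := T ∩ S) E fun h => absurd h.1 h1,
      hF.diff_singleton (S := T) E fun _ => h2] at h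
    linarith [hm _ (hsup T hT S hS), hm _ (hinf T hT S hS)]
  · refine IsLeast.csInf_eq ⟨⟨T, hT, hTE⟩, ?_⟩
    rintro _ ⟨S, hS, rfl⟩
    exact hm S hS
end

section
/- Let V be a finite type, let s, d ∈ V with s ≠ d, and let F : Set (V × V) → Set V → ℝ be a family of cut functions satisfying: (i) for every E ⊆ V × V, the function F E is submodular; (ii) for all E, E' ⊆ V × V and every S ⊆ V, if {e ∈ E | e.1 ∈ S ∧ e.2 ∉ S} = {e ∈ E' | e.1 ∈ S ∧ e.2 ∉ S} then F E S = F E' S. Then for every edge set E₀ ⊆ V × V there exists an edge set E' ⊆ E₀ containing no bidirected pair (i.e., there is no pair of distinct nodes u, w with both (u,w) ∈ E' and (w,u) ∈ E') such that the minimum of F E' over all s–d cuts equals the minimum of F E₀ over all s–d cuts. -/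
/-- The minimum over the `s`–`d` cuts is attained. -/
theorem isLeast_cutMin {V : Type*} [Finite V] {s d : V} (hsd : s ≠ d) (f : Set V → ℝ) :
    IsLeast (f '' {S : Set V | s ∈ S ∧ d ∉ S}) (cutMin s d f) := by
  have hne : (f '' {S : Set V | s ∈ S ∧ d ∉ S}).Nonempty :=
    ⟨_, {s}, ⟨rfl, fun h => hsd h.symm⟩, rfl⟩
  have hfin : (f '' {S : Set V | s ∈ S ∧ d ∉ S}).Finite := Set.toFinite _
  exact ⟨hne.csInf_mem hfin, fun _ hx => csInf_le hfin.bddBelow hx⟩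

/-- If cut values depend only on outgoing edges, removing an edge does not affect the cuts
it does not leave. -/
theorem cut_diff_singleton_eq {V : Type*} {F : Set (V × V) → Set V → ℝ}
    (hout : ∀ E E' : Set (V × V), ∀ S : Set V,
      {e ∈ E | e.1 ∈ S ∧ e.2 ∉ S} = {e ∈ E' | e.1 ∈ S ∧ e.2 ∉ S} → F E S = F E' S)
    (E : Set (V × V)) {a b : V} {S : Set V} (h : ¬ (a ∈ S ∧ b ∉ S)) :
    F (E \ {(a, b)}) S = F E S := by
  apply hout
  ext e
  simp only [Set.mem_ofPred_eq, Set.mem_sdiff, Set.mem_singleton_iff]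
  refine ⟨fun ⟨⟨hE, _⟩, hS⟩ => ⟨hE, hS⟩, fun ⟨hE, hS⟩ => ⟨⟨hE, ?_⟩, hS⟩⟩
  rintro rfl
  exact h hS

/-- If removing `(a, b)` does not affect some minimum cut but changes the minimum, then some cut
left by `(a, b)` drops strictly below the old minimum. -/
theorem exists_cut_lt_of_cutMin_diff_ne {V : Type*} [Finite V] {s d : V} (hsd : s ≠ d)
    {F : Set (V × V) → Set V → ℝ}
    (hout : ∀ E E' : Set (V × V), ∀ S : Set V,
      {e ∈ E | e.1 ∈ S ∧ e.2 ∉ S} = {e ∈ E' | e.1 ∈ S ∧ e.2 ∉ S} → F E S = F E' S)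
    {E : Set (V × V)} {a b : V} {S : Set V} (hs : s ∈ S) (hd : d ∉ S)
    (hS : F E S = cutMin s d (F E)) (hab : ¬ (a ∈ S ∧ b ∉ S))
    (hne : cutMin s d (F (E \ {(a, b)})) ≠ cutMin s d (F E)) :
    ∃ T : Set V, s ∈ T ∧ d ∉ T ∧ a ∈ T ∧ b ∉ T ∧
      F (E \ {(a, b)}) T < cutMin s d (F E) := by
  obtain ⟨⟨T, ⟨hsT, hdT⟩, hT⟩, hmin⟩ := isLeast_cutMin hsd (F (E \ {(a, b)}))
  have hle := hmin ⟨S, ⟨hs, hd⟩, rfl⟩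
  rw [cut_diff_singleton_eq hout E hab, hS] at hle
  have hlt := lt_of_le_of_ne hle hne
  rw [← hT] at hlt
  by_cases hT' : a ∈ T ∧ b ∉ T
  · exact ⟨T, hsT, hdT, hT'.1, hT'.2, hlt⟩
  · rw [cut_diff_singleton_eq hout E hT'] at hlt
    exact absurd ((isLeast_cutMin hsd (F E)).2 ⟨T, ⟨hsT, hdT⟩, rfl⟩) (not_le.2 hlt)

/-- One of the two edges of a bidirected pair can be removed without changing the minimum cut. -/
theorem cutMin_diff_eq_or_cutMin_diff_eq {V : Type*} [Finite V] {s d : V} (hsd : s ≠ d)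
    {F : Set (V × V) → Set V → ℝ}
    (hsub : ∀ E : Set (V × V), Submodular (F E))
    (hout : ∀ E E' : Set (V × V), ∀ S : Set V,
      {e ∈ E | e.1 ∈ S ∧ e.2 ∉ S} = {e ∈ E' | e.1 ∈ S ∧ e.2 ∉ S} → F E S = F E' S)
    (E : Set (V × V)) (u w : V) :
    cutMin s d (F (E \ {(u, w)})) = cutMin s d (F E) ∨
      cutMin s d (F (E \ {(w, u)})) = cutMin s d (F E) := by
  obtain ⟨⟨S, ⟨hs, hd⟩, hS⟩, hmin⟩ := isLeast_cutMin hsd (F E)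
  have hle : ∀ T : Set V, s ∈ T → d ∉ T → cutMin s d (F E) ≤ F E T :=
    fun T hsT hdT => hmin ⟨T, ⟨hsT, hdT⟩, rfl⟩
  -- A minimum cut left by `(a, b)` is incompatible with a drop caused by removing `(b, a)`.
  have key : ∀ a b : V, a ∈ S → b ∉ S →
      cutMin s d (F (E \ {(b, a)})) = cutMin s d (F E) := by
    intro a b ha hb
    by_contra hne
    obtain ⟨T, hsT, hdT, hbT, haT, hlt⟩ :=
      exists_cut_lt_of_cutMin_diff_ne hsd hout hs hd hS (fun h => hb h.1) hne
    have h := hsub (E \ {(b, a)}) S T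
    rw [cut_diff_singleton_eq hout E (S := S) (fun h => hb h.1),
      cut_diff_singleton_eq hout E (S := S ∪ T) (fun h => h.2 (Or.inl ha)),
      cut_diff_singleton_eq hout E (S := S ∩ T) (fun h => hb h.1.1)] at h
    have h₁ := hle (S ∪ T) (Or.inl hs) (fun h => h.elim hd hdT)
    have h₂ := hle (S ∩ T) ⟨hs, hsT⟩ (fun h => hd h.1)
    linarith
  by_cases huw : u ∈ S ∧ w ∉ S
  · exact Or.inr (key u w huw.1 huw.2)
  by_cases hwu : w ∈ S ∧ u ∉ S
  · exact Or.inl (key w u hwu.1 hwu.2)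
  by_contra! hne
  obtain ⟨A, hsA, hdA, huA, hwA, hA⟩ :=
    exists_cut_lt_of_cutMin_diff_ne hsd hout hs hd hS huw hne.1
  obtain ⟨B, hsB, hdB, hwB, huB, hB⟩ :=
    exists_cut_lt_of_cutMin_diff_ne hsd hout hs hd hS hwu hne.2
  have h := hsub ((E \ {(u, w)}) \ {(w, u)}) A B
  have hBeq : F ((E \ {(u, w)}) \ {(w, u)}) B = F (E \ {(w, u)}) B := by
    rw [sdiff_right_comm]
    exact cut_diff_singleton_eq hout _ (fun h => huB h.1)
  rw [hBeq, cut_diff_singleton_eq hout _ (S := A) (fun h => hwA h.1),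
    cut_diff_singleton_eq hout _ (S := A ∪ B) (fun h => h.2 (Or.inl huA)),
    cut_diff_singleton_eq hout _ (S := A ∪ B) (fun h => h.2 (Or.inr hwB)),
    cut_diff_singleton_eq hout _ (S := A ∩ B) (fun h => hwA h.1.1),
    cut_diff_singleton_eq hout _ (S := A ∩ B) (fun h => huB h.1.2)] at h
  have h₁ := hle (A ∪ B) (Or.inl hsA) (fun h => h.elim hdA hdB)
  have h₂ := hle (A ∩ B) ⟨hsA, hsB⟩ (fun h => hdA h.1)
  linarith

/-- For any family of cut functions `F` that is submodular and whose
values depend only on the edges going out of the cut, every edge set `E₀` admits a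
subset `E' ⊆ E₀` containing no bidirected pair (no distinct `u, w` with both
`(u,w) ∈ E'` and `(w,u) ∈ E'`) and having the same `s`–`d` min-cut as `E₀`. -/
theorem exists_no_bidirected_subnetwork_same_mincut {V : Type*} [Fintype V]
    (s d : V) (hsd : s ≠ d)
    (F : Set (V × V) → Set V → ℝ)
    (hsub : ∀ E : Set (V × V), Submodular (F E))
    (hout : ∀ E E' : Set (V × V), ∀ S : Set V,
      {e ∈ E | e.1 ∈ S ∧ e.2 ∉ S} = {e ∈ E' | e.1 ∈ S ∧ e.2 ∉ S} → F E S = F E' S)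
    (E₀ : Set (V × V)) :
    ∃ E' ⊆ E₀, (¬ ∃ u w : V, u ≠ w ∧ (u, w) ∈ E' ∧ (w, u) ∈ E') ∧
      cutMin s d (F E') = cutMin s d (F E₀) := by
  obtain ⟨E', ⟨hE', hcut⟩, hmin⟩ := Set.Finite.exists_minimal
    (s := {E : Set (V × V) | E ⊆ E₀ ∧ cutMin s d (F E) = cutMin s d (F E₀)})
    (Set.toFinite _) ⟨E₀, subset_rfl, rfl⟩
  have hdrop : ∀ e ∈ E', cutMin s d (F (E' \ {e})) ≠ cutMin s d (F E') := fun e he heq =>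
    (hmin ⟨Set.sdiff_subset.trans hE', heq.trans hcut⟩ Set.sdiff_subset he).2 rfl
  refine ⟨E', hE', ?_, hcut⟩
  rintro ⟨u, w, -, huw, hwu⟩
  exact (cutMin_diff_eq_or_cutMin_diff_eq hsd hsub hout E' u w).elim
    (hdrop _ huw) (hdrop _ hwu)
end

section
/- There exists an acyclic edge set E' ⊆ V × V such that the E'-subnetwork H' of H satisfies C_iid(H') = C_iid(H), i.e., the minimum of f_{H'} over all s–d cuts equals the minimum of f_H over all s–d cuts. -/
open Matrix Complex

open scoped Classical

/-- The `E`-subnetwork of the channel matrix `H`: keep the entry `H r t` if the edge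
`(τ t, ρ r)` is in `E`, and set it to zero otherwise. -/
noncomputable def subnetwork {V T Rx : Type*} (τ : T → V) (ρ : Rx → V)
    (H : Matrix Rx T ℂ) (E : Set (V × V)) : Matrix Rx T ℂ :=
  fun r t => if (τ t, ρ r) ∈ E then H r t else 0

open scoped ComplexOrder MatrixOrder

section Determinants

variable {m n : Type*} [Fintype m] [Fintype n] [DecidableEq m] [DecidableEq n]

lemma Matrix.PosSemidef.one_le_det_one_add_s9 {A : Matrix n n ℂ} (hA : A.PosSemidef) :
    1 ≤ (1 + A).det := by
  have h : (1 + A).det = ∏ i, (1 + (hA.1.eigenvalues i : ℂ)) := by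
    have h₁ := congrArg (Polynomial.eval (-1)) hA.1.charpoly_eq
    rw [Matrix.eval_charpoly, Polynomial.eval_prod] at h₁
    have h₂ : Matrix.scalar n (-1 : ℂ) - A = -(1 + A) := by
      rw [map_neg, map_one]; abel
    have h₃ : ∀ i, Polynomial.eval (-1 : ℂ)
        (Polynomial.X - Polynomial.C (hA.1.eigenvalues i : ℂ)) =
          (-1) * (1 + (hA.1.eigenvalues i : ℂ)) := fun i => by
      simp; ring
    rw [h₂, Matrix.det_neg] at h₁
    erw [Finset.prod_congr rfl fun i _ => h₃ i] at h₁
    rw [Finset.prod_mul_distrib, Finset.prod_const, Finset.card_univ] at h₁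
    exact mul_left_cancel₀ (pow_ne_zero _ (by norm_num)) h₁
  have h' : (1 + A).det = ((∏ i, (1 + hA.1.eigenvalues i) : ℝ) : ℂ) := by
    rw [h]; push_cast; rfl
  rw [h']
  have : (1 : ℝ) ≤ ∏ i, (1 + hA.1.eigenvalues i) := by
    refine Finset.prod_induction _ (fun x : ℝ => 1 ≤ x)
      (fun a b ha hb => one_le_mul_of_one_le_of_one_le ha hb) le_rfl
      (fun i _ => by linarith [hA.eigenvalues_nonneg i])
  exact_mod_cast this

lemma Matrix.PosDef.det_le_det_add_s9 {A B : Matrix n n ℂ} (hA : A.PosDef)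
    (hB : B.PosSemidef) : A.det ≤ (A + B).det := by
  obtain ⟨P, hP, hAP⟩ : ∃ P : Matrix n n ℂ, IsUnit P ∧ A = Pᴴ * P := by
    have h : ∃ b : Matrix n n ℂ, A = star b * b :=
      CStarAlgebra.nonneg_iff_eq_star_mul_self.1 hA.posSemidef.nonneg
    obtain ⟨P, hP⟩ := h
    refine ⟨P, ?_, hP⟩
    have h0 := hA.det_pos.ne'
    rw [hP, Matrix.det_mul] at h0
    exact (Matrix.isUnit_iff_isUnit_det P).2 (isUnit_iff_ne_zero.2 (right_ne_zero_of_mul h0))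
  have hdet : IsUnit P.det := (Matrix.isUnit_iff_isUnit_det P).1 hP
  have hinv : P⁻¹ * P = 1 := Matrix.nonsing_inv_mul P hdet
  have hinv' : Pᴴ * (P⁻¹)ᴴ = 1 := by rw [← Matrix.conjTranspose_mul, hinv]; simp
  have key : A + B = Pᴴ * (1 + (P⁻¹)ᴴ * B * P⁻¹) * P := by
    have : Pᴴ * (1 + (P⁻¹)ᴴ * B * P⁻¹) * P = Pᴴ * P + (Pᴴ * (P⁻¹)ᴴ) * B * (P⁻¹ * P) := by
      simp only [Matrix.mul_add, Matrix.add_mul, Matrix.mul_assoc, Matrix.mul_one]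
    rw [this, hinv, hinv', hAP]; simp
  have h1 := (hB.conjTranspose_mul_mul_same P⁻¹).one_le_det_one_add_s9
  have hdetA : A.det = Pᴴ.det * P.det := by rw [hAP, Matrix.det_mul]
  calc A.det = A.det * 1 := (mul_one _).symm
    _ ≤ A.det * (1 + (P⁻¹)ᴴ * B * P⁻¹).det := mul_le_mul_of_nonneg_left h1 hA.det_pos.le
    _ = (A + B).det := by rw [key, Matrix.det_mul, Matrix.det_mul, hdetA]; ring

lemma Matrix.PosDef.schurComplement₁₁ {A : Matrix m m ℂ} {B : Matrix m n ℂ}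
    {C : Matrix n m ℂ} {D : Matrix n n ℂ} (h : (Matrix.fromBlocks A B C D).PosDef) :
    A.PosDef ∧ C = Bᴴ ∧ (D - C * A⁻¹ * B).PosDef ∧
      (Matrix.fromBlocks A B C D).det = A.det * (D - C * A⁻¹ * B).det := by
  have hA : A.PosDef := by
    exact h.submatrix (e := Sum.inl) Sum.inl_injective
  have hC : C = Bᴴ := ((Matrix.isHermitian_fromBlocks_iff.1 h.1).2.1).symm
  have := hA.isUnit.invertible
  have hdet : (Matrix.fromBlocks A B C D).det = A.det * (D - C * A⁻¹ * B).det := by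
    rw [Matrix.det_fromBlocks₁₁, Matrix.invOf_eq_nonsing_inv]
  have hS : (D - C * A⁻¹ * B).PosSemidef := by
    subst hC
    exact (hA.fromBlocks₁₁ B D).1 h.posSemidef
  refine ⟨hA, hC, ?_, hdet⟩
  refine hS.posDef_iff_isUnit.2 ?_
  rw [Matrix.isUnit_iff_isUnit_det, isUnit_iff_ne_zero]
  intro h0
  rw [h0, mul_zero] at hdet
  exact h.det_pos.ne' hdet

/-- **Fischer's inequality** for a positive definite block matrix. -/
lemma Matrix.PosDef.det_fromBlocks_le {A : Matrix m m ℂ} {B : Matrix m n ℂ}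
    {C : Matrix n m ℂ} {D : Matrix n n ℂ} (h : (Matrix.fromBlocks A B C D).PosDef) :
    (Matrix.fromBlocks A B C D).det ≤ A.det * D.det := by
  obtain ⟨hA, hC, hS, hdet⟩ := h.schurComplement₁₁
  rw [hdet]
  refine mul_le_mul_of_nonneg_left ?_ hA.det_pos.le
  have hW : (C * A⁻¹ * B).PosSemidef := by
    rw [hC]; exact hA.inv.posSemidef.conjTranspose_mul_mul_same B
  simpa using hS.det_le_det_add_s9 hW

omit [Fintype n] [DecidableEq n] in
lemma Matrix.det_submatrix_eq_of_range_eq {α β : Type*} [Fintype α] [Fintype β]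
    [DecidableEq α] [DecidableEq β] (N : Matrix n n ℂ) {a : α → n} {b : β → n}
    (ha : a.Injective) (hb : b.Injective)
    (h : Set.range a = Set.range b) : (N.submatrix a a).det = (N.submatrix b b).det := by
  let e : α ≃ β := (Equiv.ofInjective a ha).trans
    ((Equiv.setCongr h).trans (Equiv.ofInjective b hb).symm)
  have he : ∀ i, b (e i) = a i := fun i => by
    simp [e, Equiv.apply_ofInjective_symm]
  rw [← Matrix.det_submatrix_equiv_self e (N.submatrix b b), Matrix.submatrix_submatrix]
  congr 2 <;> exact funext fun i => (he i).symm

lemma Matrix.PosDef.det_submatrix_sum_mul_le {x y z : Type*} [Fintype x] [Fintype y] [Fintype z]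
    [DecidableEq x] [DecidableEq y] [DecidableEq z]
    {N : Matrix (x ⊕ (y ⊕ z)) (x ⊕ (y ⊕ z)) ℂ} (hN : N.PosDef) :
    N.det * (N.submatrix Sum.inl Sum.inl).det ≤
      (N.submatrix (Sum.map id Sum.inl) (Sum.map id Sum.inl)).det *
        (N.submatrix (Sum.map id Sum.inr) (Sum.map id Sum.inr)).det := by
  have hy : (N.submatrix (Sum.map (id : x → x) (Sum.inl : y → y ⊕ z))
      (Sum.map (id : x → x) Sum.inl)).PosDef :=
    hN.submatrix (Function.Injective.sumMap Function.injective_id Sum.inl_injective)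
  have hz : (N.submatrix (Sum.map (id : x → x) (Sum.inr : z → y ⊕ z))
      (Sum.map (id : x → x) Sum.inr)).PosDef :=
    hN.submatrix (Function.Injective.sumMap Function.injective_id Sum.inr_injective)
  rw [← Matrix.fromBlocks_toBlocks (N.submatrix (Sum.map id Sum.inl) (Sum.map id Sum.inl))] at hy ⊢
  rw [← Matrix.fromBlocks_toBlocks (N.submatrix (Sum.map id Sum.inr) (Sum.map id Sum.inr))] at hz ⊢
  rw [hy.schurComplement₁₁.2.2.2, hz.schurComplement₁₁.2.2.2]
  rw [← Matrix.fromBlocks_toBlocks N] at hN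
  obtain ⟨hA, hC, hS, hdet⟩ := hN.schurComplement₁₁
  rw [← Matrix.fromBlocks_toBlocks (_ - _)] at hS
  have hF := hS.det_fromBlocks_le
  rw [Matrix.fromBlocks_toBlocks] at hF
  rw [Matrix.fromBlocks_toBlocks] at hdet
  have h0 := hA.det_pos.le
  calc N.det * N.toBlocks₁₁.det
      = N.toBlocks₁₁.det * N.toBlocks₁₁.det *
        (N.toBlocks₂₂ - N.toBlocks₂₁ * N.toBlocks₁₁⁻¹ * N.toBlocks₁₂).det := by rw [hdet]; ring
    _ ≤ N.toBlocks₁₁.det * N.toBlocks₁₁.det * _ :=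
        mul_le_mul_of_nonneg_left hF (mul_nonneg h0 h0)
    _ = _ := mul_mul_mul_comm _ _ _ _

omit [Fintype n] in
/-- **Koteljanskii's inequality**: the determinants of the principal submatrices of a positive
definite matrix are log-submodular. -/
lemma Matrix.PosDef.det_submatrix_union_mul_inter_le {α β γ δ : Type*} [Fintype α] [Fintype β]
    [Fintype γ] [Fintype δ] [DecidableEq α] [DecidableEq β] [DecidableEq γ] [DecidableEq δ]
    {N : Matrix n n ℂ} (hN : N.PosDef)
    {a : α → n} {b : β → n} {c : γ → n} {e : δ → n}
    (ha : a.Injective) (hb : b.Injective) (hc : c.Injective) (he : e.Injective)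
    (hunion : Set.range c = Set.range a ∪ Set.range b)
    (hinter : Set.range e = Set.range a ∩ Set.range b) :
    (N.submatrix c c).det * (N.submatrix e e).det ≤
      (N.submatrix a a).det * (N.submatrix b b).det := by
  let y := {i // i ∈ Set.range a \ Set.range b}
  let z := {i // i ∈ Set.range b \ Set.range a}
  let j : δ ⊕ (y ⊕ z) → n := Sum.elim e (Sum.elim Subtype.val Subtype.val)
  have hy : Set.range (Subtype.val : y → n) = Set.range a \ Set.range b := Subtype.range_coe
  have hz : Set.range (Subtype.val : z → n) = Set.range b \ Set.range a := Subtype.range_coe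
  have hej : ∀ d, e d ∈ Set.range a ∩ Set.range b := fun d => hinter ▸ Set.mem_range_self d
  have hj : j.Injective := by
    refine he.sumElim (Subtype.val_injective.sumElim Subtype.val_injective ?_) ?_
    · rintro ⟨i, hi⟩ ⟨k, hk⟩ rfl; exact hi.2 hk.1
    · rintro d (⟨i, hi⟩ | ⟨i, hi⟩) h
      · exact hi.2 ((show e d = i from h) ▸ (hej d).2)
      · exact hi.2 ((show e d = i from h) ▸ (hej d).1)
  have key := (hN.submatrix hj).det_submatrix_sum_mul_le
  simp only [Matrix.submatrix_submatrix] at key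
  rw [N.det_submatrix_eq_of_range_eq (a := j) hj hc,
    N.det_submatrix_eq_of_range_eq (a := j ∘ Sum.inl) (hj.comp Sum.inl_injective) he,
    N.det_submatrix_eq_of_range_eq (a := j ∘ Sum.map id Sum.inl) (hj.comp
      (Function.Injective.sumMap Function.injective_id Sum.inl_injective)) ha,
    N.det_submatrix_eq_of_range_eq (a := j ∘ Sum.map id Sum.inr) (hj.comp
      (Function.Injective.sumMap Function.injective_id Sum.inr_injective)) hb] at key
  · exact key
  · simp only [j, Sum.elim_comp_map, Set.Sum.elim_range, Sum.elim_comp_inr, Function.comp_id, hz,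
      hinter]
    rw [Set.inter_comm, Set.inter_union_sdiff]
  · simp only [j, Sum.elim_comp_map, Set.Sum.elim_range, Sum.elim_comp_inl, Function.comp_id, hy,
      hinter]
    rw [Set.inter_union_sdiff]
  · simp [j]
  · simp only [j, Set.Sum.elim_range, hy, hz, hinter, hunion]
    ext i
    simp only [Set.mem_union, Set.mem_inter_iff, Set.mem_sdiff]
    tauto

end Determinants

section BiCut

variable {V T Rx : Type*} [Fintype T] [Fintype Rx] (τ : T → V) (ρ : Rx → V)

/-- The matrix from the transmit antennas of the nodes in `A` to the receive antennas of the nodes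
outside `D`. -/
def biCutMatrix {V T Rx : Type*} (τ : T → V) (ρ : Rx → V)
    (H : Matrix Rx T ℂ) (A D : Set V) : Matrix {r : Rx // ρ r ∉ D} {t : T // τ t ∈ A} ℂ :=
  fun r t => H r.1 t.1

/-- The determinant of the covariance of the signal received outside `D` when only the nodes in `A`
transmit. -/
noncomputable def biCutDet (H : Matrix Rx T ℂ) (p : T → ℝ) (A D : Set V) : ℂ :=
  (1 + biCutMatrix τ ρ H A D *
    Matrix.diagonal (fun t : {t : T // τ t ∈ A} => (p t.1 : ℂ)) * (biCutMatrix τ ρ H A D)ᴴ).det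

/-- The mutual information between the signals sent by `A` and those received outside `D`. -/
noncomputable def biCutValue (H : Matrix Rx T ℂ) (p : T → ℝ) (A D : Set V) : ℝ :=
  Real.log (biCutDet τ ρ H p A D).re

lemma biCutValue_self (H : Matrix Rx T ℂ) (p : T → ℝ) (S : Set V) :
    biCutValue τ ρ H p S S = cutValue τ ρ H p S := rfl

lemma one_le_biCutDet (H : Matrix Rx T ℂ) {p : T → ℝ} (hp : ∀ t, 0 ≤ p t) (A D : Set V) :
    1 ≤ biCutDet τ ρ H p A D := by
  refine Matrix.PosSemidef.one_le_det_one_add_s9 ?_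
  refine Matrix.PosSemidef.mul_mul_conjTranspose_same (Matrix.PosSemidef.diagonal fun t => ?_) _
  exact Complex.zero_le_real.2 (hp t.1)

lemma biCutValue_nonneg (H : Matrix Rx T ℂ) {p : T → ℝ} (hp : ∀ t, 0 ≤ p t) (A D : Set V) :
    0 ≤ biCutValue τ ρ H p A D :=
  Real.log_nonneg (Complex.le_def.1 (one_le_biCutDet τ ρ H hp A D)).1

lemma biCutValue_empty (H : Matrix Rx T ℂ) (p : T → ℝ) (D : Set V) :
    biCutValue τ ρ H p ∅ D = 0 := by
  have h : ∀ M : Matrix {r : Rx // ρ r ∉ D} {t : T // τ t ∈ (∅ : Set V)} ℂ, M = 0 :=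
    fun M => Matrix.ext fun _ t => t.2.elim
  simp [biCutValue, biCutDet, h (biCutMatrix τ ρ H ∅ D)]

lemma biCutValue_subnetwork (H : Matrix Rx T ℂ) (p : T → ℝ) {E : Set (V × V)} {A D : Set V}
    (h : ∀ u ∈ A, ∀ w ∉ D, (u, w) ∈ E) :
    biCutValue τ ρ (subnetwork τ ρ H E) p A D = biCutValue τ ρ H p A D := by
  have : biCutMatrix τ ρ (subnetwork τ ρ H E) A D = biCutMatrix τ ρ H A D :=
    Matrix.ext fun r t => if_pos (h _ t.2 _ r.2)
  simp only [biCutValue, biCutDet, this]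

/-- The joint covariance of the received and of the normalized transmitted signals. -/
noncomputable def signalCov {T Rx : Type*} [Fintype T] (H : Matrix Rx T ℂ) (p : T → ℝ) :
    Matrix (Rx ⊕ T) (Rx ⊕ T) ℂ :=
  let K := H * Matrix.diagonal (fun t => (√(p t) : ℂ))
  Matrix.fromBlocks (1 + K * Kᴴ) K Kᴴ 1

lemma posDef_signalCov (H : Matrix Rx T ℂ) (p : T → ℝ) : (signalCov H p).PosDef := by
  unfold signalCov
  set K := H * Matrix.diagonal (fun t => (√(p t) : ℂ))
  have hfac : Matrix.fromBlocks (1 + K * Kᴴ) K Kᴴ 1 =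
      Matrix.fromBlocks 1 K 0 1 * (Matrix.fromBlocks 1 K 0 1)ᴴ := by
    simp [Matrix.fromBlocks_conjTranspose, Matrix.fromBlocks_multiply]
  refine (Matrix.PosSemidef.posDef_iff_det_ne_zero ?_).2 ?_
  · rw [hfac]; exact Matrix.posSemidef_self_mul_conjTranspose _
  · simp [Matrix.det_fromBlocks_one₂₂]

lemma signalCov_submatrix_det (H : Matrix Rx T ℂ) {p : T → ℝ} (hp : ∀ t, 0 ≤ p t) (A D : Set V) :
    ((signalCov H p).submatrix
      (Sum.map (Subtype.val : {r // ρ r ∉ D} → Rx) (Subtype.val : {t // τ t ∉ A} → T))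
      (Sum.map Subtype.val Subtype.val)).det = biCutDet τ ρ H p A D := by
  unfold signalCov
  set K := H * Matrix.diagonal (fun t => (√(p t) : ℂ)) with hK
  have hblock : (Matrix.fromBlocks (1 + K * Kᴴ) K Kᴴ 1).submatrix
      (Sum.map (Subtype.val : {r // ρ r ∉ D} → Rx) (Subtype.val : {t // τ t ∉ A} → T))
      (Sum.map (Subtype.val : {r // ρ r ∉ D} → Rx) (Subtype.val : {t // τ t ∉ A} → T)) =
      Matrix.fromBlocks ((1 + K * Kᴴ).submatrix Subtype.val Subtype.val)
        (K.submatrix Subtype.val Subtype.val) (Kᴴ.submatrix Subtype.val Subtype.val) 1 := by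
    ext (i | i) (j | j) <;> simp [Matrix.one_apply, Subtype.ext_iff]
  have hterm : ∀ i j t, K i t * star (K j t) = H i t * p t * star (H j t) := fun i j t => by
    have h2 : (√(p t) : ℂ) * √(p t) = p t := by
      rw [← Complex.ofReal_mul, Real.mul_self_sqrt (hp t)]
    simp only [hK, Matrix.mul_diagonal, star_mul', RCLike.star_def, Complex.conj_ofReal]
    linear_combination (H i t * (starRingEnd ℂ) (H j t)) * h2
  simp only [hblock, biCutDet]
  rw [Matrix.det_fromBlocks_one₂₂]
  congr 1
  ext i j
  have hsum := Fintype.sum_subtype_add_sum_subtype (fun t => τ t ∈ A)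
    (fun t => K i.1 t * star (K j.1 t))
  simp only [Matrix.sub_apply, Matrix.add_apply, Matrix.submatrix_apply, Matrix.mul_apply,
    Matrix.conjTranspose_apply, biCutMatrix, Matrix.one_apply, Subtype.ext_iff]
  rw [← hsum]
  simp only [hterm, Matrix.diagonal_apply, mul_ite, mul_zero, Finset.sum_ite_eq', Finset.mem_univ,
    if_true]
  ring

lemma biCutValue_submodular (H : Matrix Rx T ℂ) {p : T → ℝ} (hp : ∀ t, 0 ≤ p t)
    (A D A' D' : Set V) :
    biCutValue τ ρ H p (A ∪ A') (D ∪ D') + biCutValue τ ρ H p (A ∩ A') (D ∩ D') ≤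
      biCutValue τ ρ H p A D + biCutValue τ ρ H p A' D' := by
  have hinj : ∀ A D : Set V, Function.Injective (Sum.map (Subtype.val : {r // ρ r ∉ D} → Rx)
      (Subtype.val : {t // τ t ∉ A} → T)) := fun A D =>
    Function.Injective.sumMap Subtype.val_injective Subtype.val_injective
  have hrange : ∀ A D : Set V, Set.range (Sum.map (Subtype.val : {r // ρ r ∉ D} → Rx)
      (Subtype.val : {t // τ t ∉ A} → T)) =
        {i | Sum.elim (fun r => ρ r ∉ D) (fun t => τ t ∉ A) i} := by
    intro A D
    ext (i | i) <;> simp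
  have key : ∀ A₁ D₁ A₂ D₂ : Set V, A₁ = A ∪ A' → D₁ = D ∪ D' → A₂ = A ∩ A' → D₂ = D ∩ D' →
      biCutDet τ ρ H p A₁ D₁ * biCutDet τ ρ H p A₂ D₂ ≤
        biCutDet τ ρ H p A D * biCutDet τ ρ H p A' D' := by
    intro A₁ D₁ A₂ D₂ hA₁ hD₁ hA₂ hD₂
    have h := (posDef_signalCov H p).det_submatrix_union_mul_inter_le (hinj A D) (hinj A' D')
      (hinj A₂ D₂) (hinj A₁ D₁)
      (by simp only [hrange, hA₂, hD₂]; ext (i | i) <;> simp <;> tauto)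
      (by simp only [hrange, hA₁, hD₁]; ext (i | i) <;> simp)
    simp only [signalCov_submatrix_det τ ρ H hp] at h
    rwa [mul_comm]
  replace key := key _ _ _ _ rfl rfl rfl rfl
  have hre : ∀ A D : Set V, ((biCutDet τ ρ H p A D).re : ℂ) = biCutDet τ ρ H p A D ∧
      0 < (biCutDet τ ρ H p A D).re := fun A D => by
    have h := Complex.le_def.1 (one_le_biCutDet τ ρ H hp A D)
    refine ⟨Complex.ext rfl ?_, lt_of_lt_of_le one_pos h.1⟩
    simpa using h.2
  rw [← (hre (A ∪ A') (D ∪ D')).1, ← (hre (A ∩ A') (D ∩ D')).1, ← (hre A D).1,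
    ← (hre A' D').1, ← Complex.ofReal_mul, ← Complex.ofReal_mul, Complex.real_le_real] at key
  simp only [biCutValue]
  rw [← Real.log_mul (hre _ _).2.ne' (hre _ _).2.ne',
    ← Real.log_mul (hre _ _).2.ne' (hre _ _).2.ne']
  exact Real.log_le_log (mul_pos (hre _ _).2 (hre _ _).2) key

end BiCut

section Submodular

variable {V : Type*} [Fintype V]

/-- A real function on a lattice is submodular. -/
def IsSubmodular {α : Type*} [Lattice α] (g : α → ℝ) : Prop :=
  ∀ X Y, g (X ⊔ Y) + g (X ⊓ Y) ≤ g X + g Y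

/-- The throughput `z` leaving `X.1` minus the throughput entering `X.2`. -/
def netThroughput {V : Type*} (z : V → ℝ) (X : Finset V × Finset V) : ℝ :=
  ∑ v ∈ X.1, z v - ∑ v ∈ X.2, z v

/-- The throughputs that can be supported under the bound `g`. -/
def IsFeasible {V : Type*} (g : Finset V × Finset V → ℝ) (z : V → ℝ) : Prop :=
  ∀ X, netThroughput z X ≤ g X

omit [Fintype V] in
lemma netThroughput_sup_add_inf (z : V → ℝ) (X Y : Finset V × Finset V) :
    netThroughput z (X ⊔ Y) + netThroughput z (X ⊓ Y) =
      netThroughput z X + netThroughput z Y := by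
  have h₁ := Finset.sum_union_inter (s₁ := X.1) (s₂ := Y.1) (f := z)
  have h₂ := Finset.sum_union_inter (s₁ := X.2) (s₂ := Y.2) (f := z)
  simp only [netThroughput, Prod.fst_sup, Prod.snd_sup, Prod.fst_inf, Prod.snd_inf,
    Finset.sup_eq_union, Finset.inf_eq_inter]
  linarith

omit [Fintype V] in
lemma IsSubmodular.sub_netThroughput {g : Finset V × Finset V → ℝ} (hg : IsSubmodular g)
    (z : V → ℝ) : IsSubmodular fun X => g X - netThroughput z X := fun X Y => by
  have := netThroughput_sup_add_inf z X Y
  have := hg X Y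
  linarith

omit [Fintype V] in
lemma netThroughput_add_single (z : V → ℝ) (c : ℝ) (v : V) (X : Finset V × Finset V) :
    netThroughput (z + Pi.single v c) X =
      netThroughput z X + ((if v ∈ X.1 then c else 0) - (if v ∈ X.2 then c else 0)) := by
  simp only [netThroughput, Pi.add_apply, Finset.sum_add_distrib, Finset.sum_pi_single']
  ring

/-- A submodular bound that is nonnegative on cuts admits a feasible throughput. -/
lemma IsSubmodular.exists_isFeasible {g : Finset V × Finset V → ℝ} (hg : IsSubmodular g)
    (h0 : ∀ S, 0 ≤ g (S, S)) : ∃ z, IsFeasible g z := by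
  suffices h : ∀ U : Finset V, ∃ z : V → ℝ, ∀ X : Finset V × Finset V,
      (∀ u ∉ U, (u ∈ X.1 ↔ u ∈ X.2)) → netThroughput z X ≤ g X by
    obtain ⟨z, hz⟩ := h Finset.univ
    exact ⟨z, fun X => hz X fun u hu => absurd (Finset.mem_univ u) hu⟩
  intro U
  induction U using Finset.induction with
  | empty =>
    refine ⟨0, fun X hX => ?_⟩
    have : X.1 = X.2 := Finset.ext fun u => hX u (Finset.notMem_empty u)
    obtain ⟨A, D⟩ := X
    obtain rfl : A = D := this
    simpa [netThroughput] using h0 A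
  | insert v U _ ih =>
    obtain ⟨z, hz⟩ := ih
    let G := fun X => g X - netThroughput z X
    have hG : IsSubmodular G := hg.sub_netThroughput z
    let P := Finset.univ.filter fun X : Finset V × Finset V =>
      (∀ u ∉ insert v U, (u ∈ X.1 ↔ u ∈ X.2)) ∧ v ∈ X.1 ∧ v ∉ X.2
    have hP : P.Nonempty := ⟨({v}, ∅), by
      simp only [P, Finset.mem_filter_univ]
      refine ⟨fun u hu => ?_, by simp, by simp⟩
      have : u ≠ v := fun h => hu (h ▸ Finset.mem_insert_self _ _)
      simp [this]⟩
    obtain ⟨X₀, hX₀, hmin⟩ := Finset.exists_min_image P G hP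
    simp only [P, Finset.mem_filter_univ] at hX₀ hmin
    refine ⟨z + Pi.single v (G X₀), fun X hX => ?_⟩
    rw [netThroughput_add_single]
    have hsame : (v ∈ X.1 ↔ v ∈ X.2) → netThroughput z X ≤ g X := fun h => hz X fun u hu => by
      by_cases huv : u = v
      · rw [huv]; exact h
      · exact hX u (by simp [huv, hu])
    by_cases h₁ : v ∈ X.1 <;> by_cases h₂ : v ∈ X.2
    · simpa [h₁, h₂] using hsame (by simp [h₁, h₂])
    · have := hmin X ⟨hX, h₁, h₂⟩
      simp only [h₁, h₂, if_true, if_false, G] at this ⊢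
      linarith
    · have hsub := hG X X₀
      have hagree : ∀ u ∉ U, (u ∈ X.1 ↔ u ∈ X.2) ∧ (u ∈ X₀.1 ↔ u ∈ X₀.2) ∨ u = v := by
        intro u hu
        by_cases huv : u = v
        · exact Or.inr huv
        · exact Or.inl ⟨hX u (by simp [huv, hu]), hX₀.1 u (by simp [huv, hu])⟩
      have hsup : netThroughput z (X ⊔ X₀) ≤ g (X ⊔ X₀) := hz _ fun u hu => by
        rcases hagree u hu with h | rfl
        · simp [h.1, h.2]
        · simp [h₂, hX₀.2.1]
      have hinf : netThroughput z (X ⊓ X₀) ≤ g (X ⊓ X₀) := hz _ fun u hu => by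
        rcases hagree u hu with h | rfl
        · simp [h.1, h.2]
        · simp [h₁, hX₀.2.2]
      simp only [h₁, h₂, if_true, if_false, G] at hsub ⊢
      linarith
    · simpa [h₁, h₂] using hsame (by simp [h₁, h₂])

lemma exists_isFeasible_sum_minimal {g : Finset V × Finset V → ℝ} (h : ∃ z, IsFeasible g z) :
    ∃ z, IsFeasible g z ∧ ∀ z', IsFeasible g z' → ∑ v, z v ≤ ∑ v, z' v := by
  obtain ⟨z₀, hz₀⟩ := h
  let l : V → ℝ := fun v => -g (∅, {v})
  have hl : ∀ z, IsFeasible g z → ∀ v, l v ≤ z v := fun z hz v => by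
    have := hz (∅, {v})
    simp only [netThroughput, Finset.sum_empty, Finset.sum_singleton] at this
    simp only [l]; linarith
  let K := {z | IsFeasible g z} ∩ {z | ∑ v, z v ≤ ∑ v, z₀ v}
  have hclosed : IsClosed K := by
    refine IsClosed.inter ?_ (isClosed_le (by fun_prop) continuous_const)
    have : {z | IsFeasible g z} = ⋂ X, {z | netThroughput z X ≤ g X} := by
      ext z; simp [IsFeasible]
    rw [this]
    refine isClosed_iInter fun X => isClosed_le ?_ continuous_const
    unfold netThroughput
    fun_prop
  have hsub : K ⊆ Set.Icc l (fun v => ∑ u, z₀ u - ∑ u ∈ Finset.univ.erase v, l u) := by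
    rintro z ⟨hz, hsum⟩
    refine ⟨hl z hz, fun v => ?_⟩
    have h₁ := Finset.add_sum_erase Finset.univ z (Finset.mem_univ v)
    have h₂ : ∑ u ∈ Finset.univ.erase v, l u ≤ ∑ u ∈ Finset.univ.erase v, z u :=
      Finset.sum_le_sum fun u _ => hl z hz u
    have h₃ : ∑ v, z v ≤ ∑ v, z₀ v := hsum
    show z v ≤ _
    linarith
  have hK : IsCompact K := isCompact_Icc.of_isClosed_subset hclosed hsub
  obtain ⟨z, hz, hmin⟩ := hK.exists_isMinOn ⟨z₀, hz₀, le_refl (∑ v, z₀ v)⟩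
    (f := fun z : V → ℝ => ∑ v, z v) (by fun_prop)
  refine ⟨z, hz.1, fun z' hz' => ?_⟩
  rcases le_total (∑ v, z' v) (∑ v, z₀ v) with h | h
  · exact hmin ⟨hz', h⟩
  · exact le_trans hz.2 h

/-- The pairs at which the feasible throughput `z` attains the bound `g`. -/
def IsTight {V : Type*} (g : Finset V × Finset V → ℝ) (z : V → ℝ) (X : Finset V × Finset V) :
    Prop :=
  netThroughput z X = g X

omit [Fintype V] in
lemma IsTight.sup_inf {g : Finset V × Finset V → ℝ} (hg : IsSubmodular g) {z : V → ℝ}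
    (hz : IsFeasible g z) {X Y : Finset V × Finset V} (hX : IsTight g z X) (hY : IsTight g z Y) :
    IsTight g z (X ⊔ Y) ∧ IsTight g z (X ⊓ Y) := by
  unfold IsTight at *
  have h₁ := netThroughput_sup_add_inf z X Y
  have h₂ := hg X Y
  have h₃ := hz (X ⊔ Y)
  have h₄ := hz (X ⊓ Y)
  constructor <;> linarith

/-- If every node of a nonempty set `W` passes its throughput on to a node of `W`, in the sense of
the tight pairs, then the total throughput is not minimal. -/
lemma sum_not_minimal_of_injOn {g : Finset V × Finset V → ℝ} {z : V → ℝ}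
    (hz : IsFeasible g z) (hmin : ∀ z', IsFeasible g z' → ∑ v, z v ≤ ∑ v, z' v)
    {W : Finset V} (hW : W.Nonempty) {φ : V → V} (hφ : Set.InjOn φ W) (hmaps : Set.MapsTo φ W W)
    (ht : ∀ X, IsTight g z X → ∀ v ∈ W, v ∈ X.2 → φ v ∈ X.1) : False := by
  obtain ⟨ε, hε, hgap⟩ : ∃ ε > 0, ∀ X, ¬ IsTight g z X →
      ε * (Fintype.card V : ℝ) ≤ g X - netThroughput z X := by
    by_cases hne : (Finset.univ.filter fun X => ¬ IsTight g z X).Nonempty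
    · obtain ⟨X₀, hX₀, hX₀min⟩ :=
        Finset.exists_min_image _ (fun X => g X - netThroughput z X) hne
      simp only [Finset.mem_filter_univ] at hX₀ hX₀min
      have hpos : 0 < g X₀ - netThroughput z X₀ :=
        sub_pos.2 (lt_of_le_of_ne (hz X₀) hX₀)
      have hcard : 0 < (Fintype.card V : ℝ) := by
        exact_mod_cast Fintype.card_pos_iff.2 ⟨hW.choose⟩
      refine ⟨_, div_pos hpos hcard, fun X hX => ?_⟩
      rw [div_mul_cancel₀ _ hcard.ne']
      exact hX₀min X hX
    · exact ⟨1, one_pos, fun X hX => absurd ⟨X, by simpa using hX⟩ hne⟩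
  let z' : V → ℝ := fun v => z v - if v ∈ W then ε else 0
  have hsum : ∀ S : Finset V, ∑ v ∈ S, z' v = ∑ v ∈ S, z v - ε * ((S ∩ W).card : ℝ) := by
    intro S
    simp only [z', Finset.sum_sub_distrib, Finset.sum_ite_mem, Finset.sum_const, nsmul_eq_mul]
    ring
  have hfeas : IsFeasible g z' := by
    intro X
    have hnet : netThroughput z' X = netThroughput z X +
        ε * (((X.2 ∩ W).card : ℝ) - (X.1 ∩ W).card) := by
      simp only [netThroughput, hsum]; ring
    rw [hnet]
    by_cases hX : IsTight g z X
    · have hle : (X.2 ∩ W).card ≤ (X.1 ∩ W).card := by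
        refine Finset.card_le_card_of_injOn φ (fun v hv => ?_) (hφ.mono fun v hv => ?_)
        · have hv' := Finset.mem_inter.1 hv
          exact Finset.mem_coe.2 (Finset.mem_inter.2 ⟨ht X hX v hv'.2 hv'.1, hmaps hv'.2⟩)
        · exact (Finset.mem_inter.1 hv).2
      have hle' : ((X.2 ∩ W).card : ℝ) ≤ (X.1 ∩ W).card := by exact_mod_cast hle
      have := hz X
      nlinarith
    · have h₁ : ((X.2 ∩ W).card : ℝ) ≤ Fintype.card V := by
        exact_mod_cast Finset.card_le_univ _
      have h₂ : (0 : ℝ) ≤ (X.1 ∩ W).card := Nat.cast_nonneg _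
      have := hgap X hX
      nlinarith
  have hle := hmin z' hfeas
  rw [hsum, Finset.univ_inter] at hle
  have : 0 < ε * (W.card : ℝ) := mul_pos hε (by exact_mod_cast hW.card_pos)
  linarith

omit [Fintype V] in
/-- A nonempty set mapped to itself contains a nonempty subset on which the map is injective. -/
lemma exists_nonempty_subset_injOn {W : Finset V} (hW : W.Nonempty) {φ : V → V}
    (hφ : Set.MapsTo φ W W) :
    ∃ W' ⊆ W, W'.Nonempty ∧ Set.MapsTo φ W' W' ∧ Set.InjOn φ W' := by
  let Q := W.powerset.filter fun W' : Finset V => W'.Nonempty ∧ Set.MapsTo φ W' W'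
  obtain ⟨W', hW', hmin⟩ := Finset.exists_min_image Q Finset.card
    ⟨W, by simpa [Q] using ⟨hW, hφ⟩⟩
  simp only [Q, Finset.mem_filter, Finset.mem_powerset] at hW' hmin
  refine ⟨W', hW'.1, hW'.2.1, hW'.2.2, Finset.card_image_iff.1 ?_⟩
  refine le_antisymm Finset.card_image_le (hmin _ ⟨?_, hW'.2.1.image φ, ?_⟩)
  · intro v hv
    obtain ⟨u, hu, rfl⟩ := Finset.mem_image.1 hv
    exact hW'.1 (hW'.2.2 hu)
  · intro v hv
    obtain ⟨u, hu, rfl⟩ := Finset.mem_image.1 (Finset.mem_coe.1 hv)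
    exact Finset.mem_coe.2 (Finset.mem_image_of_mem φ (hW'.2.2 hu))

/-- For a feasible throughput of minimal sum there is a chain of tight pairs such that every node
is entered but not left by some member of the chain. -/
lemma exists_chain_isTight {g : Finset V × Finset V → ℝ} (hg : IsSubmodular g)
    (hbot : g ⊥ = 0) {z : V → ℝ} (hz : IsFeasible g z)
    (hmin : ∀ z', IsFeasible g z' → ∑ v, z v ≤ ∑ v, z' v) :
    ∃ C : Finset (Finset V × Finset V), IsChain (· ≤ ·) (C : Set (Finset V × Finset V)) ∧
      (∀ X ∈ C, IsTight g z X) ∧ ∀ v, ∃ X ∈ C, v ∈ X.2 ∧ v ∉ X.1 := by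
  let P : Finset V → Prop := fun U => ∃ C : Finset (Finset V × Finset V), ∃ J,
    IsChain (· ≤ ·) (C : Set (Finset V × Finset V)) ∧ (∀ X ∈ C, IsTight g z X) ∧
      (∀ v ∈ U, ∃ X ∈ C, v ∈ X.2 ∧ v ∉ X.1) ∧ (∀ X ∈ C, X ≤ J) ∧ IsTight g z J ∧ J.1 ⊆ U
  have hP : P ∅ := ⟨∅, ⊥, by simp, by simp, by simp, by simp,
    by simp [IsTight, hbot, netThroughput], by simp⟩
  obtain ⟨U, hU, hUmax⟩ := Finset.exists_max_image (Finset.univ.filter P) Finset.card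
    ⟨∅, by simpa using hP⟩
  simp only [Finset.mem_filter_univ] at hU hUmax
  obtain ⟨C, J, hC, hCt, hCU, hCJ, hJ, hJU⟩ := hU
  by_cases hUuniv : U = Finset.univ
  · exact ⟨C, hC, hCt, fun v => hCU v (hUuniv ▸ Finset.mem_univ v)⟩
  exfalso
  have hstep : ∀ v, ∃ u, v ∉ U → u ∉ U ∧ ∀ X, IsTight g z X → v ∈ X.2 → u ∈ X.1 := by
    intro v
    by_cases hv : v ∈ U
    · exact ⟨v, fun h => absurd hv h⟩
    by_contra! hcon
    obtain ⟨Y, hY, hYv, hYU⟩ : ∃ Y, IsTight g z Y ∧ v ∈ Y.2 ∧ Y.1 ⊆ U := by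
      choose _ F hF using fun u : {u // u ∉ U} => (hcon u.1).imp_right (· u.2)
      have hne : (Finset.univ : Finset {u // u ∉ U}).Nonempty := ⟨⟨v, hv⟩, Finset.mem_univ _⟩
      refine ⟨Finset.univ.inf' hne F, ?_, ?_, ?_⟩
      · exact Finset.inf'_induction hne F (fun X hX Y hY => (hX.sup_inf hg hz hY).2)
          fun u _ => (hF u).1
      · have : (⊥, {v}) ≤ Finset.univ.inf' hne F := Finset.le_inf' _ _ fun u _ =>
          ⟨bot_le, by simpa using (hF u).2.1⟩
        exact this.2 (Finset.mem_singleton_self v)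
      · intro u hu
        by_contra huU
        have : Finset.univ.inf' hne F ≤ F ⟨u, huU⟩ := Finset.inf'_le _ (Finset.mem_univ _)
        exact (hF ⟨u, huU⟩).2.2 (this.1 hu)
    have hmem : v ∈ (J ⊔ Y).2 := by simp [hYv]
    have hsubU : (J ⊔ Y).1 ⊆ U := Finset.union_subset hJU hYU
    have hlarger : P (insert v U) := by
      refine ⟨insert (J ⊔ Y) C, J ⊔ Y, ?_, ?_, ?_, ?_, (hJ.sup_inf hg hz hY).1,
        hsubU.trans (Finset.subset_insert _ _)⟩
      · rw [Finset.coe_insert]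
        exact hC.insert fun X hX _ => Or.inr ((hCJ X hX).trans le_sup_left)
      · simpa using ⟨(hJ.sup_inf hg hz hY).1, fun A D h => hCt (A, D) h⟩
      · intro w hw
        rcases Finset.mem_insert.1 hw with rfl | hw
        · exact ⟨_, Finset.mem_insert_self _ _, hmem, fun h => hv (hsubU h)⟩
        · obtain ⟨X, hX, h⟩ := hCU w hw
          exact ⟨X, Finset.mem_insert_of_mem hX, h⟩
      · intro X hX
        rcases Finset.mem_insert.1 hX with rfl | hX
        · exact le_rfl
        · exact (hCJ X hX).trans le_sup_left
    have := hUmax _ hlarger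
    rw [Finset.card_insert_of_notMem hv] at this
    omega
  choose φ hφ using hstep
  have hne : Uᶜ.Nonempty := by
    rwa [Finset.nonempty_iff_ne_empty, Ne, Finset.compl_eq_empty_iff]
  obtain ⟨W, hWU, hW, hmaps, hinj⟩ := exists_nonempty_subset_injOn hne (φ := φ) fun v hv => by
    simp only [Finset.coe_compl, Set.mem_compl_iff, Finset.mem_coe] at hv ⊢
    exact (hφ v hv).1
  exact sum_not_minimal_of_injOn hz hmin hW hinj hmaps fun X hX v hv hvX =>
    (hφ v (Finset.mem_compl.1 (hWU hv))).2 X hX hvX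

/-- The edges along which no member of `C` is entered without being left. -/
def chainEdges {V : Type*} (C : Finset (Finset V × Finset V)) : Set (V × V) :=
  {e | ∀ X ∈ C, e.2 ∈ X.2 → e.1 ∈ X.1}

omit [Fintype V] in
lemma mem_chainEdges {C : Finset (Finset V × Finset V)} {X : Finset V × Finset V}
    (hX : ∀ Y ∈ C, X ≤ Y ∨ Y ≤ X) {u w : V} (hu : u ∈ X.1) (hw : w ∉ X.2) :
    (u, w) ∈ chainEdges C := fun Y hY hwY =>
  (hX Y hY).elim (fun h => h.1 hu) fun h => absurd (h.2 hwY) hw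

omit [Fintype V] in
lemma acyclicEdgeSet_chainEdges {C : Finset (Finset V × Finset V)}
    (hC : IsChain (· ≤ ·) (C : Set (Finset V × Finset V)))
    (hsep : ∀ v, ∃ X ∈ C, v ∈ X.2 ∧ v ∉ X.1) : AcyclicEdgeSet (chainEdges C) := by
  let a : V → ℕ := fun v => (C.filter fun X => v ∉ X.1).card
  have hlt : ∀ u w, (u, w) ∈ chainEdges C → a u < a w := by
    intro u w huw
    obtain ⟨Y, hY, hw₂, hw₁⟩ := hsep w
    refine Finset.card_lt_card (Finset.ssubset_iff_of_subset ?_ |>.2 ⟨Y, ?_, ?_⟩)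
    · intro X hX
      simp only [Finset.mem_filter] at hX ⊢
      refine ⟨hX.1, fun hwX => hX.2 (huw X hX.1 ?_)⟩
      rcases hC.total (Finset.mem_coe.2 hX.1) (Finset.mem_coe.2 hY) with h | h
      · exact absurd (h.1 hwX) hw₁
      · exact h.2 hw₂
    · exact Finset.mem_filter.2 ⟨hY, hw₁⟩
    · exact fun h => (Finset.mem_filter.1 h).2 (huw Y hY hw₂)
  intro v hv
  have : ∀ u w, Relation.TransGen (fun u w => (u, w) ∈ chainEdges C) u w → a u < a w := by
    intro u w h
    induction h with
    | single h => exact hlt _ _ h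
    | tail _ h ih => exact ih.trans (hlt _ _ h)
  exact lt_irrefl _ (this v v hv)

omit [Fintype V] in
/-- A submodular function that is nonnegative at all elements comparable with the whole chain `C`
and vanishes on `C` is nonnegative. -/
lemma IsSubmodular.nonneg_of_chain {α : Type*} [Lattice α] {g : α → ℝ} (hg : IsSubmodular g)
    {C : Finset α} (hC : IsChain (· ≤ ·) (C : Set α)) (hzero : ∀ X ∈ C, g X = 0)
    (hnonneg : ∀ X, (∀ Y ∈ C, X ≤ Y ∨ Y ≤ X) → 0 ≤ g X) (X : α) : 0 ≤ g X := by
  induction hn : (C.filter fun Y => ¬ (X ≤ Y ∨ Y ≤ X)).card using Nat.strong_induction_on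
    generalizing X with
  | _ n ih =>
    by_cases hX : ∀ Y ∈ C, X ≤ Y ∨ Y ≤ X
    · exact hnonneg X hX
    · push Not at hX
      obtain ⟨Y, hY, hXY⟩ := hX
      have hYmem : Y ∈ C.filter fun Y => ¬ (X ≤ Y ∨ Y ≤ X) :=
        Finset.mem_filter.2 ⟨hY, not_or.2 hXY⟩
      have hlt : ∀ X', (∀ Z ∈ C, (X ≤ Z ∨ Z ≤ X) → (X' ≤ Z ∨ Z ≤ X')) → (X' ≤ Y ∨ Y ≤ X') →
          0 ≤ g X' := by
        intro X' h h'
        refine ih _ ?_ X' rfl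
        rw [← hn]
        refine Finset.card_lt_card ((Finset.ssubset_iff_of_subset fun Z hZ => ?_).2
          ⟨Y, hYmem, fun h => (Finset.mem_filter.1 h).2 h'⟩)
        rw [Finset.mem_filter] at hZ ⊢
        exact ⟨hZ.1, fun hc => hZ.2 (h Z hZ.1 hc)⟩
      have hsup : 0 ≤ g (X ⊔ Y) := hlt _ (fun Z hZ hXZ => by
        rcases hC.total (Finset.mem_coe.2 hY) (Finset.mem_coe.2 hZ) with hYZ | hYZ
        · rcases hXZ with hXZ | hXZ
          · exact Or.inl (sup_le hXZ hYZ)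
          · exact Or.inr (hXZ.trans le_sup_left)
        · exact Or.inr (hYZ.trans le_sup_right)) (Or.inr le_sup_right)
      have hinf : 0 ≤ g (X ⊓ Y) := hlt _ (fun Z hZ hXZ => by
        rcases hC.total (Finset.mem_coe.2 hY) (Finset.mem_coe.2 hZ) with hYZ | hYZ
        · exact Or.inl (inf_le_right.trans hYZ)
        · rcases hXZ with hXZ | hXZ
          · exact Or.inl (inf_le_left.trans hXZ)
          · exact Or.inr (le_inf hXZ hYZ)) (Or.inl inf_le_right)
      have := hg X Y
      rw [hzero Y hY] at this
      linarith

omit [Fintype V] in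
/-- If `g'` agrees with `g` at all pairs that only involve edges of the chain `C`, then every
throughput that is feasible for `g` and tight on `C` is feasible for `g'`. -/
lemma IsFeasible.of_chainEdges {g g' : Finset V × Finset V → ℝ} (hg' : IsSubmodular g')
    {z : V → ℝ} (hz : IsFeasible g z) {C : Finset (Finset V × Finset V)}
    (hC : IsChain (· ≤ ·) (C : Set (Finset V × Finset V))) (ht : ∀ X ∈ C, IsTight g z X)
    (heq : ∀ X : Finset V × Finset V,
      (∀ u ∈ X.1, ∀ w ∉ X.2, (u, w) ∈ chainEdges C) → g' X = g X) : IsFeasible g' z := by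
  have hcomp : ∀ X : Finset V × Finset V, (∀ Y ∈ C, X ≤ Y ∨ Y ≤ X) → g' X = g X :=
    fun X hX => heq X fun _ hu _ hw => mem_chainEdges hX hu hw
  intro X
  refine sub_nonneg.1 ((hg'.sub_netThroughput z).nonneg_of_chain hC (fun Y hY => ?_)
    (fun Y hY => ?_) X)
  · rw [hcomp Y fun Z hZ => hC.total (Finset.mem_coe.2 hY) (Finset.mem_coe.2 hZ), ht Y hY,
      sub_self]
  · rw [hcomp Y hY]
    exact sub_nonneg.2 (hz Y)

/-- A chain through a given tight cut. -/
lemma exists_chain_isTight_mem {g : Finset V × Finset V → ℝ} (hg : IsSubmodular g)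
    (hbot : g ⊥ = 0) {z : V → ℝ} (hz : IsFeasible g z)
    (hmin : ∀ z', IsFeasible g z' → ∑ v, z v ≤ ∑ v, z' v) {S : Finset V}
    (hS : IsTight g z (S, S)) :
    ∃ C : Finset (Finset V × Finset V), IsChain (· ≤ ·) (C : Set (Finset V × Finset V)) ∧
      (∀ X ∈ C, IsTight g z X) ∧ (∀ v, ∃ X ∈ C, v ∈ X.2 ∧ v ∉ X.1) ∧ (S, S) ∈ C := by
  obtain ⟨C, hC, ht, hsep⟩ := exists_chain_isTight hg hbot hz hmin
  let C' := insert (S, S) (C.image (· ⊓ (S, S)) ∪ C.image (· ⊔ (S, S)))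
  have hC' : ∀ X ∈ C', X = (S, S) ∨ (∃ Y ∈ C, Y ⊓ (S, S) = X) ∨ ∃ Y ∈ C, Y ⊔ (S, S) = X := by
    intro X hX
    simpa only [C', Finset.mem_insert, Finset.mem_union, Finset.mem_image] using hX
  have hmemInf : ∀ Y ∈ C, Y ⊓ (S, S) ∈ C' := fun Y hY => Finset.mem_insert_of_mem
    (Finset.mem_union_left _ (Finset.mem_image_of_mem (· ⊓ (S, S)) hY))
  have hmemSup : ∀ Y ∈ C, Y ⊔ (S, S) ∈ C' := fun Y hY => Finset.mem_insert_of_mem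
    (Finset.mem_union_right _ (Finset.mem_image_of_mem (· ⊔ (S, S)) hY))
  refine ⟨C', ?_, ?_, ?_, Finset.mem_insert_self _ _⟩
  · intro X hX X' hX' _
    rcases hC' X hX with rfl | ⟨Y, hY, rfl⟩ | ⟨Y, hY, rfl⟩ <;>
      rcases hC' X' hX' with rfl | ⟨Y', hY', rfl⟩ | ⟨Y', hY', rfl⟩
    · exact Or.inl le_rfl
    · exact Or.inr inf_le_right
    · exact Or.inl le_sup_right
    · exact Or.inl inf_le_right
    · exact (hC.total hY hY').imp (inf_le_inf_right _) (inf_le_inf_right _)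
    · exact Or.inl (inf_le_right.trans le_sup_right)
    · exact Or.inr le_sup_right
    · exact Or.inr (inf_le_right.trans le_sup_right)
    · exact (hC.total hY hY').imp (sup_le_sup_right · _) (sup_le_sup_right · _)
  · intro X hX
    rcases hC' X hX with rfl | ⟨Y, hY, rfl⟩ | ⟨Y, hY, rfl⟩
    · exact hS
    · exact ((ht Y hY).sup_inf hg hz hS).2
    · exact ((ht Y hY).sup_inf hg hz hS).1
  · intro v
    obtain ⟨Y, hY, h₂, h₁⟩ := hsep v
    by_cases hv : v ∈ S
    · exact ⟨_, hmemInf Y hY, by simp [h₂, hv], by simp [h₁]⟩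
    · exact ⟨_, hmemSup Y hY, by simp [h₂], by simp [h₁, hv]⟩

end Submodular

/-- The bi-cut value in excess of a demand of rate `c` from `s` to `d`. -/
noncomputable def excessCut {V T Rx : Type*} [Fintype T] [Fintype Rx] (τ : T → V) (ρ : Rx → V)
    (H : Matrix Rx T ℂ) (p : T → ℝ) (s d : V) (c : ℝ) (X : Finset V × Finset V) : ℝ :=
  biCutValue τ ρ H p X.1 X.2 - (if s ∈ X.1 then c else 0) + (if d ∈ X.2 then c else 0)

lemma isSubmodular_excessCut {V T Rx : Type*} [Fintype T] [Fintype Rx] (τ : T → V) (ρ : Rx → V)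
    (H : Matrix Rx T ℂ) {p : T → ℝ} (hp : ∀ t, 0 ≤ p t) (s d : V) (c : ℝ) :
    IsSubmodular (excessCut τ ρ H p s d c) := by
  intro X Y
  have h := biCutValue_submodular τ ρ H hp (X.1 : Set V) X.2 Y.1 Y.2
  have hmod : ∀ (v : V) (A B : Finset V), (if v ∈ A ∪ B then c else 0) +
      (if v ∈ A ∩ B then c else 0) = (if v ∈ A then c else 0) + (if v ∈ B then c else 0) := by
    intro v A B
    by_cases hA : v ∈ A <;> by_cases hB : v ∈ B <;> simp [hA, hB]
  have hs := hmod s X.1 Y.1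
  have hd := hmod d X.2 Y.2
  simp only [excessCut, Prod.fst_sup, Prod.snd_sup, Prod.fst_inf, Prod.snd_inf,
    Finset.sup_eq_union, Finset.inf_eq_inter, Finset.coe_union, Finset.coe_inter]
  linarith

/-- Every Gaussian unicast network admits an acyclic subnetwork with
the same i.i.d.-evaluated cutset bound: there is an acyclic edge set `E' ⊆ V × V` such
that the `E'`-subnetwork `H'` of `H` satisfies `C_iid(H') = C_iid(H)`. -/
theorem exists_acyclic_gaussian_subnetwork_same_Ciid
    {V T Rx : Type*} [Fintype V] [Fintype T] [Fintype Rx]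
    (τ : T → V) (ρ : Rx → V) (H : Matrix Rx T ℂ) (p : T → ℝ) (hp : ∀ t, 0 ≤ p t)
    (s d : V) (hsd : s ≠ d) :
    ∃ E' : Set (V × V), AcyclicEdgeSet E' ∧
      cutMin s d (cutValue τ ρ (subnetwork τ ρ H E') p) =
        cutMin s d (cutValue τ ρ H p) := by
  obtain ⟨S, hS, hSmin⟩ := Set.exists_min_image {S : Set V | s ∈ S ∧ d ∉ S}
    (cutValue τ ρ H p) (Set.toFinite _) ⟨{s}, rfl, fun h => hsd h.symm⟩
  have hcap : 0 ≤ cutValue τ ρ H p S := biCutValue_nonneg τ ρ H hp S S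
  set c := cutValue τ ρ H p S with hc
  have hcut : ∀ S' : Finset V, 0 ≤ excessCut τ ρ H p s d c (S', S') := by
    intro S'
    have h₀ := biCutValue_nonneg τ ρ H hp (S' : Set V) S'
    by_cases hs : s ∈ S' <;> by_cases hd : d ∈ S'
    · simpa [excessCut, hs, hd] using h₀
    · have := hSmin S' ⟨by simpa using hs, by simpa using hd⟩
      simpa [excessCut, hs, hd, biCutValue_self] using this
    · simpa [excessCut, hs, hd] using add_nonneg h₀ hcap
    · simpa [excessCut, hs, hd] using h₀
  have hsub := fun H : Matrix Rx T ℂ => isSubmodular_excessCut τ ρ H hp s d c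
  obtain ⟨z, hz, hmin⟩ := exists_isFeasible_sum_minimal ((hsub H).exists_isFeasible hcut)
  have hbot : excessCut τ ρ H p s d c ⊥ = 0 := by simp [excessCut, biCutValue_empty]
  have htight : IsTight (excessCut τ ρ H p s d c) z (S.toFinset, S.toFinset) := by
    simp [IsTight, netThroughput, excessCut, hS.1, hS.2, biCutValue_self, hc]
  obtain ⟨C, hC, ht, hsep, hSC⟩ := exists_chain_isTight_mem (hsub H) hbot hz hmin htight
  have hfeas : IsFeasible (excessCut τ ρ (subnetwork τ ρ H (chainEdges C)) p s d c) z :=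
    hz.of_chainEdges (hsub _) hC ht fun X hX => by
      simp only [excessCut]
      rw [biCutValue_subnetwork τ ρ H p (by simpa using hX)]
  refine ⟨chainEdges C, acyclicEdgeSet_chainEdges hC hsep, ?_⟩
  have hval : cutValue τ ρ (subnetwork τ ρ H (chainEdges C)) p S = c := by
    refine biCutValue_subnetwork τ ρ H p (fun u hu w hw => ?_)
    exact mem_chainEdges (fun Y hY => hC.total (Finset.mem_coe.2 hSC) (Finset.mem_coe.2 hY))
      (Set.mem_toFinset.2 hu) (Set.mem_toFinset.not.2 hw)
  have hleast : IsLeast (cutValue τ ρ (subnetwork τ ρ H (chainEdges C)) p ''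
      {S : Set V | s ∈ S ∧ d ∉ S}) c := by
    refine ⟨⟨S, hS, hval⟩, ?_⟩
    rintro _ ⟨S', ⟨hs, hd⟩, rfl⟩
    have := hfeas (S'.toFinset, S'.toFinset)
    simpa [netThroughput, excessCut, hs, hd, biCutValue_self] using this
  have hleast₀ : IsLeast (cutValue τ ρ H p '' {S : Set V | s ∈ S ∧ d ∉ S}) c :=
    ⟨⟨S, hS, rfl⟩, by rintro _ ⟨S', hS', rfl⟩; exact hSmin S' hS'⟩
  exact hleast.csInf_eq.trans hleast₀.csInf_eq.symm
end
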